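/- (Theorem 1, Marton) For every discrete memoryless broadcast channel, the Marton region is contained in the no-feedback capacity region: R_Marton ⊆ C_NoFB. -/

import Mathlib

open scoped BigOperators Classical

noncomputable section

namespace BCFB

variable {Ω A B C : Type*}

/-- Probability of an event under a weight function on a finite sample space. -/
def prOf [Fintype Ω] (w : Ω → ℝ) (E : Ω → Prop) : ℝ :=
  ∑ ω, if E ω then w ω else 0

/-- Distribution (pushforward) of a random variable. -/
def distOf [Fintype Ω] (w : Ω → ℝ) (X : Ω → A) : A → ℝ :=
  fun a => prOf w fun ω => X ω = a

/-- Shannon entropy (base 2) of a random variable. -/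
def entOf [Fintype Ω] [Fintype A] (w : Ω → ℝ) (X : Ω → A) : ℝ :=
  -∑ a, distOf w X a * Real.logb 2 (distOf w X a)

/-- Mutual information (base 2). -/
def miOf [Fintype Ω] [Fintype A] [Fintype B] (w : Ω → ℝ) (X : Ω → A) (Y : Ω → B) : ℝ :=
  entOf w X + entOf w Y - entOf w fun ω => (X ω, Y ω)

/-- Conditional mutual information I(X;Y|Z) (base 2). -/
def cmiOf [Fintype Ω] [Fintype A] [Fintype B] [Fintype C]
    (w : Ω → ℝ) (X : Ω → A) (Y : Ω → B) (Z : Ω → C) : ℝ :=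
  entOf w (fun ω => (X ω, Z ω)) + entOf w (fun ω => (Y ω, Z ω))
    - entOf w (fun ω => (X ω, Y ω, Z ω)) - entOf w Z

/-- `w` is a probability mass function. -/
def IsPMF [Fintype Ω] (w : Ω → ℝ) : Prop := (∀ ω, 0 ≤ w ω) ∧ ∑ ω, w ω = 1

/-- `k` is a transition kernel (each row a pmf). -/
def IsKernel {A B : Type*} [Fintype A] [Fintype B] (k : A → B → ℝ) : Prop :=
  ∀ a, IsPMF (k a)

/-- `X — Y — Z` forms a Markov chain (i.e. `X` and `Z` are conditionally
independent given `Y`). -/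
def MarkovChain [Fintype Ω] (w : Ω → ℝ) (X : Ω → A) (Y : Ω → B) (Z : Ω → C) : Prop :=
  ∀ a b c,
    distOf w (fun ω => (X ω, Y ω, Z ω)) (a, b, c) * distOf w Y b
      = distOf w (fun ω => (X ω, Y ω)) (a, b) * distOf w (fun ω => (Z ω, Y ω)) (c, b)

/-- `X` and `Y` are independent. -/
def IndepRV [Fintype Ω] (w : Ω → ℝ) (X : Ω → A) (Y : Ω → B) : Prop :=
  ∀ a b, distOf w (fun ω => (X ω, Y ω)) (a, b) = distOf w X a * distOf w Y b

/-- Number of messages of rate `R` and blocklength `n`: `⌊2^{nR}⌋`. -/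
def msgCard (n : ℕ) (R : ℝ) : ℕ := ⌊(2 : ℝ) ^ ((n : ℝ) * R)⌋₊

/-- Binary entropy function. -/
def hb (u : ℝ) : ℝ := -(u * Real.logb 2 u) - (1 - u) * Real.logb 2 (1 - u)

/-- Empirical frequency of the letter `a` in the sequence `x`. -/
def freqOf {A : Type*} {n : ℕ} (x : Fin n → A) (a : A) : ℝ :=
  ((Finset.univ.filter fun t => x t = a).card : ℝ) / n

/-- `ε`-typicality of a sequence w.r.t. a pmf `P`. -/
def Typical {A : Type*} (ε : ℝ) {n : ℕ} (P : A → ℝ) (x : Fin n → A) : Prop :=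
  ∀ a, |freqOf x a - P a| ≤ ε * P a

section NoFB

variable {X Y1 Y2 : Type*} [Fintype X] [Fintype Y1] [Fintype Y2]

/-- Error probability of a blocklength-`n` no-feedback code over the DMBC `W`. -/
def errProbNoFB (W : X → Y1 × Y2 → ℝ) (n : ℕ) (R0 R1 R2 : ℝ)
    (enc : Fin (msgCard n R0) × Fin (msgCard n R1) × Fin (msgCard n R2) → Fin n → X)
    (dec1 : (Fin n → Y1) → Fin (msgCard n R0) × Fin (msgCard n R1))
    (dec2 : (Fin n → Y2) → Fin (msgCard n R0) × Fin (msgCard n R2)) : ℝ :=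
  (1 / ((msgCard n R0 : ℝ) * (msgCard n R1 : ℝ) * (msgCard n R2 : ℝ))) *
    ∑ m : Fin (msgCard n R0) × Fin (msgCard n R1) × Fin (msgCard n R2),
      ∑ y : Fin n → Y1 × Y2,
        (∏ t, W (enc m t) (y t)) *
          (if dec1 (fun t => (y t).1) ≠ (m.1, m.2.1) ∨ dec2 (fun t => (y t).2) ≠ (m.1, m.2.2)
            then 1 else 0)

/-- Achievability of a rate triple over the DMBC `W` without feedback. -/
def AchievableNoFB (W : X → Y1 × Y2 → ℝ) (R0 R1 R2 : ℝ) : Prop :=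
  0 ≤ R0 ∧ 0 ≤ R1 ∧ 0 ≤ R2 ∧
    ∃ enc : (n : ℕ) →
        Fin (msgCard n R0) × Fin (msgCard n R1) × Fin (msgCard n R2) → Fin n → X,
    ∃ dec1 : (n : ℕ) → (Fin n → Y1) → Fin (msgCard n R0) × Fin (msgCard n R1),
    ∃ dec2 : (n : ℕ) → (Fin n → Y2) → Fin (msgCard n R0) × Fin (msgCard n R2),
      Filter.Tendsto (fun n => errProbNoFB W n R0 R1 R2 (enc n) (dec1 n) (dec2 n))
        Filter.atTop (nhds 0)

/-- The no-feedback capacity region. -/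
def CNoFB (W : X → Y1 × Y2 → ℝ) : Set (ℝ × ℝ × ℝ) :=
  closure {r | AchievableNoFB W r.1 r.2.1 r.2.2}

end NoFB

section FB

variable {X Y1 Y2 Yt : Type*} [Fintype X] [Fintype Y1] [Fintype Y2] [Fintype Yt]

/-- Causality: the time-`t` channel input depends only on feedback symbols before time `t`. -/
def Causal {X Yt : Type*} (n : ℕ) {M : Type*} (enc : Fin n → M → (Fin n → Yt) → X) : Prop :=
  ∀ (t : Fin n) (m : M) (fb fb' : Fin n → Yt),
    (∀ s : Fin n, (s : ℕ) < (t : ℕ) → fb s = fb' s) → enc t m fb = enc t m fb'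

/-- Error probability of a blocklength-`n` feedback code over the DMBC with
generalized feedback `W`. -/
def errProbFB (W : X → Y1 × Y2 × Yt → ℝ) (n : ℕ) (R0 R1 R2 : ℝ)
    (enc : Fin n → Fin (msgCard n R0) × Fin (msgCard n R1) × Fin (msgCard n R2) →
      (Fin n → Yt) → X)
    (dec1 : (Fin n → Y1) → Fin (msgCard n R0) × Fin (msgCard n R1))
    (dec2 : (Fin n → Y2) → Fin (msgCard n R0) × Fin (msgCard n R2)) : ℝ :=
  (1 / ((msgCard n R0 : ℝ) * (msgCard n R1 : ℝ) * (msgCard n R2 : ℝ))) *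
    ∑ m : Fin (msgCard n R0) × Fin (msgCard n R1) × Fin (msgCard n R2),
      ∑ y : Fin n → Y1 × Y2 × Yt,
        (∏ t, W (enc t m fun s => (y s).2.2) (y t)) *
          (if dec1 (fun t => (y t).1) ≠ (m.1, m.2.1) ∨
              dec2 (fun t => (y t).2.1) ≠ (m.1, m.2.2)
            then 1 else 0)

/-- Achievability of a rate triple over the DMBC with generalized feedback `W`. -/
def AchievableFB (W : X → Y1 × Y2 × Yt → ℝ) (R0 R1 R2 : ℝ) : Prop :=
  0 ≤ R0 ∧ 0 ≤ R1 ∧ 0 ≤ R2 ∧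
    ∃ enc : (n : ℕ) → Fin n →
        Fin (msgCard n R0) × Fin (msgCard n R1) × Fin (msgCard n R2) → (Fin n → Yt) → X,
    ∃ dec1 : (n : ℕ) → (Fin n → Y1) → Fin (msgCard n R0) × Fin (msgCard n R1),
    ∃ dec2 : (n : ℕ) → (Fin n → Y2) → Fin (msgCard n R0) × Fin (msgCard n R2),
      (∀ n, Causal n (enc n)) ∧
      Filter.Tendsto (fun n => errProbFB W n R0 R1 R2 (enc n) (dec1 n) (dec2 n))
        Filter.atTop (nhds 0)

/-- Capacity region of the DMBC with generalized feedback `W`. -/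
def CGenFB (W : X → Y1 × Y2 × Yt → ℝ) : Set (ℝ × ℝ × ℝ) :=
  closure {r | AchievableFB W r.1 r.2.1 r.2.2}

end FB

/-- Extension of a DMBC to a generalized-feedback channel with noiseless feedback
`Ỹ = (Y₁, Y₂)`. -/
def noiselessExt {X Y1 Y2 : Type*} (W : X → Y1 × Y2 → ℝ) :
    X → Y1 × Y2 × (Y1 × Y2) → ℝ :=
  fun x y => if y.2.2 = (y.1, y.2.1) then W x (y.1, y.2.1) else 0

/-- Capacity region of a DMBC with noiseless feedback. -/
def CNoiselessFB {X Y1 Y2 : Type*} [Fintype X] [Fintype Y1] [Fintype Y2]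
    (W : X → Y1 × Y2 → ℝ) : Set (ℝ × ℝ × ℝ) :=
  CGenFB (noiselessExt W)

section Marton

variable {X Y1 Y2 : Type*} [Fintype X] [Fintype Y1] [Fintype Y2]

/-- The single-letter Marton constraints for the rate triple `(R0,R1,R2)`. -/
def MartonCond (W : X → Y1 × Y2 → ℝ) (R0 R1 R2 : ℝ) : Prop :=
  ∃ (k0 k1 k2 : ℕ) (p : Fin k0 × Fin k1 × Fin k2 → ℝ)
    (f : Fin k0 × Fin k1 × Fin k2 → X), IsPMF p ∧
    (let w : (Fin k0 × Fin k1 × Fin k2) × Y1 × Y2 → ℝ := fun z => p z.1 * W (f z.1) z.2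
     let U0 := fun z : (Fin k0 × Fin k1 × Fin k2) × Y1 × Y2 => z.1.1
     let U1 := fun z : (Fin k0 × Fin k1 × Fin k2) × Y1 × Y2 => z.1.2.1
     let U2 := fun z : (Fin k0 × Fin k1 × Fin k2) × Y1 × Y2 => z.1.2.2
     let Yr1 := fun z : (Fin k0 × Fin k1 × Fin k2) × Y1 × Y2 => z.2.1
     let Yr2 := fun z : (Fin k0 × Fin k1 × Fin k2) × Y1 × Y2 => z.2.2
     R0 < min (miOf w U0 Yr1) (miOf w U0 Yr2) ∧
     R0 + R1 < miOf w (fun z => (U0 z, U1 z)) Yr1 ∧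
     R0 + R2 < miOf w (fun z => (U0 z, U2 z)) Yr2 ∧
     R0 + R1 + R2 < cmiOf w U1 Yr1 U0 + cmiOf w U2 Yr2 U0
       + min (miOf w U0 Yr1) (miOf w U0 Yr2) - cmiOf w U1 U2 U0)

/-- Marton's achievable region for the DMBC `W` without feedback. -/
def MartonRegion (W : X → Y1 × Y2 → ℝ) : Set (ℝ × ℝ × ℝ) :=
  closure {r | 0 ≤ r.1 ∧ 0 ≤ r.2.1 ∧ 0 ≤ r.2.2 ∧ MartonCond W r.1 r.2.1 r.2.2}

end Marton

end BCFB

namespace BCFB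

/-! ### Expectations over finite weights -/

section Expectation

variable {α β ι κ : Type*} [Fintype α] [Fintype β] [Fintype ι]

/-- Expectation of `F` under the weight function `w`. -/
def wExp (w : α → ℝ) (F : α → ℝ) : ℝ := ∑ a, w a * F a

/-- Product weight on a finite function space. -/
def piW (q : ι → α → ℝ) (f : ι → α) : ℝ := ∏ i, q i (f i)

lemma wExp_mono {w : α → ℝ} (hw : IsPMF w) {F G : α → ℝ} (h : ∀ a, F a ≤ G a) :
    wExp w F ≤ wExp w G :=
  Finset.sum_le_sum fun a _ => mul_le_mul_of_nonneg_left (h a) (hw.1 a)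

lemma wExp_const {w : α → ℝ} (hw : IsPMF w) (c : ℝ) : wExp w (fun _ => c) = c := by
  simp [wExp, ← Finset.sum_mul, hw.2]

lemma wExp_le_of_le {w : α → ℝ} (hw : IsPMF w) {F : α → ℝ} {c : ℝ} (h : ∀ a, F a ≤ c) :
    wExp w F ≤ c :=
  (wExp_mono hw h).trans_eq (wExp_const hw c)

lemma wExp_nonneg {w : α → ℝ} (hw : IsPMF w) {F : α → ℝ} (h : ∀ a, 0 ≤ F a) : 0 ≤ wExp w F :=
  Finset.sum_nonneg fun a _ => mul_nonneg (hw.1 a) (h a)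

lemma wExp_add (w : α → ℝ) (F G : α → ℝ) :
    wExp w (fun a => F a + G a) = wExp w F + wExp w G := by
  simp [wExp, mul_add, Finset.sum_add_distrib]

lemma wExp_sub (w : α → ℝ) (F G : α → ℝ) :
    wExp w (fun a => F a - G a) = wExp w F - wExp w G := by
  simp [wExp, mul_sub, Finset.sum_sub_distrib]

lemma wExp_const_mul (w : α → ℝ) (c : ℝ) (F : α → ℝ) :
    wExp w (fun a => c * F a) = c * wExp w F := by
  simp only [wExp, Finset.mul_sum]
  exact Finset.sum_congr rfl fun a _ => by ring

lemma wExp_mul_const (w : α → ℝ) (c : ℝ) (F : α → ℝ) :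
    wExp w (fun a => F a * c) = wExp w F * c := by
  simp only [wExp, Finset.sum_mul]
  exact Finset.sum_congr rfl fun a _ => by ring

lemma wExp_sum (w : α → ℝ) (s : Finset κ) (F : κ → α → ℝ) :
    wExp w (fun a => ∑ k ∈ s, F k a) = ∑ k ∈ s, wExp w (F k) := by
  simp only [wExp, Finset.mul_sum]
  exact Finset.sum_comm

lemma wExp_comm (w : α → ℝ) (v : β → ℝ) (F : α → β → ℝ) :
    wExp w (fun a => wExp v fun b => F a b) = wExp v (fun b => wExp w fun a => F a b) := by
  simp only [wExp, Finset.mul_sum]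
  rw [Finset.sum_comm]
  exact Finset.sum_congr rfl fun a _ => Finset.sum_congr rfl fun b _ => by ring

lemma exists_le_wExp {w : α → ℝ} (hw : IsPMF w) (F : α → ℝ) : ∃ a, F a ≤ wExp w F := by
  by_contra! h
  have h1 : wExp w (fun a => F a - wExp w F) = 0 := by
    rw [wExp_sub, wExp_const hw, sub_self]
  have h2 := (Finset.sum_eq_zero_iff_of_nonneg
    (fun a _ => mul_nonneg (hw.1 a) (sub_nonneg.2 (h a).le))).1 h1
  have h3 : ∑ a, w a = 0 := Finset.sum_eq_zero fun a ha =>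
    (mul_eq_zero.1 (h2 a ha)).resolve_right (sub_ne_zero.2 (h a).ne')
  rw [hw.2] at h3
  exact one_ne_zero h3

lemma sum_piW [DecidableEq ι] (q : ι → α → ℝ) : ∑ f, piW q f = ∏ i, ∑ a, q i a := by
  simp [piW, Finset.prod_univ_sum]

lemma isPMF_piW [DecidableEq ι] {q : ι → α → ℝ} (hq : ∀ i, IsPMF (q i)) : IsPMF (piW q) :=
  ⟨fun f => Finset.prod_nonneg fun i _ => (hq i).1 _, by
    rw [sum_piW]; exact Finset.prod_eq_one fun i _ => (hq i).2⟩

/-- Resampling one coordinate of a product weight does not change an expectation. -/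
lemma wExp_piW_resample [DecidableEq ι] {q : ι → α → ℝ} (hq : ∀ i, IsPMF (q i)) (i : ι)
    (F : (ι → α) → ℝ) :
    wExp (piW q) F = wExp (piW q) fun f => wExp (q i) fun a => F (Function.update f i a) := by
  have key : ∀ (f : ι → α) (a : α),
      piW q f * q i a = piW q (Function.update f i a) * q i (f i) := by
    intro f a
    simp only [piW]
    rw [← Finset.mul_prod_erase _ _ (Finset.mem_univ i),
      ← Finset.mul_prod_erase _ (fun j => q j (Function.update f i a j)) (Finset.mem_univ i)]
    have : ∏ x ∈ Finset.univ.erase i, q x (Function.update f i a x)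
        = ∏ x ∈ Finset.univ.erase i, q x (f x) :=
      Finset.prod_congr rfl fun x hx => by
        rw [Function.update_of_ne (Finset.ne_of_mem_erase hx)]
    rw [this, Function.update_self]
    ring
  simp only [wExp]
  have h1 : ∑ f, piW q f * F f = ∑ x : (ι → α) × α, piW q x.1 * q i x.2 * F x.1 := by
    rw [Fintype.sum_prod_type]
    refine Finset.sum_congr rfl fun f _ => ?_
    change _ = ∑ y, piW q f * q i y * F f
    rw [← Finset.sum_mul, ← Finset.mul_sum, (hq i).2, mul_one]
  have h2 : ∑ f, piW q f * ∑ a, q i a * F (Function.update f i a)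
      = ∑ x : (ι → α) × α, piW q x.1 * q i x.2 * F (Function.update x.1 i x.2) := by
    rw [Fintype.sum_prod_type]
    refine Finset.sum_congr rfl fun f _ => ?_
    rw [Finset.mul_sum]
    exact Finset.sum_congr rfl fun a _ => by ring
  rw [h1, h2]
  refine Finset.sum_bij' (fun x _ => (Function.update x.1 i x.2, x.1 i))
    (fun x _ => (Function.update x.1 i x.2, x.1 i)) (fun _ _ => Finset.mem_univ _)
    (fun _ _ => Finset.mem_univ _) ?_ ?_ ?_
  · rintro ⟨f, a⟩ _; simp
  · rintro ⟨f, a⟩ _; simp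
  · rintro ⟨f, a⟩ _
    simp only [Function.update_idem, Function.update_eq_self]
    rw [key]

lemma wExp_piW_eval [DecidableEq ι] {q : ι → α → ℝ} (hq : ∀ i, IsPMF (q i)) (i : ι)
    (F : α → ℝ) : wExp (piW q) (fun f => F (f i)) = wExp (q i) F := by
  rw [wExp_piW_resample hq i]
  simp [wExp_const (isPMF_piW hq)]

end Expectation

/-- Real-valued indicator of a proposition. -/
def ind (P : Prop) : ℝ := if P then 1 else 0

lemma ind_nonneg (P : Prop) : 0 ≤ ind P := by unfold ind; split_ifs <;> norm_num

lemma ind_le_one (P : Prop) : ind P ≤ 1 := by unfold ind; split_ifs <;> norm_num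

lemma ind_true {P : Prop} (h : P) : ind P = 1 := if_pos h

lemma ind_false {P : Prop} (h : ¬P) : ind P = 0 := if_neg h

lemma ind_mono {P Q : Prop} (h : P → Q) : ind P ≤ ind Q := by
  by_cases hP : P
  · rw [ind_true hP, ind_true (h hP)]
  · rw [ind_false hP]; exact ind_nonneg _

lemma ind_or_le (P Q : Prop) : ind (P ∨ Q) ≤ ind P + ind Q := by
  by_cases hP : P <;> by_cases hQ : Q <;> simp [ind, hP, hQ]

lemma ind_exists_le {κ : Type*} (s : Finset κ) (P : κ → Prop) :
    ind (∃ k ∈ s, P k) ≤ ∑ k ∈ s, ind (P k) := by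
  by_cases h : ∃ k ∈ s, P k
  · obtain ⟨k, hk, hP⟩ := h
    refine (ind_le_one _).trans ?_
    rw [← ind_true hP]
    exact Finset.single_le_sum (f := fun k => ind (P k)) (fun _ _ => ind_nonneg _) hk
  · rw [ind_false h]
    exact Finset.sum_nonneg fun _ _ => ind_nonneg _

/-! ### A weighted second-moment covering bound -/

section Covering

variable {U V I J : Type*} [Fintype U] [Fintype V] [Fintype I] [Fintype J]
  [DecidableEq I] [DecidableEq J]

lemma wExp_piW_pair_eq {p : U → ℝ} {q : V → ℝ} (hp : IsPMF p) (hq : IsPMF q)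
    (F : U → V → ℝ) (i : I) (j : J) :
    wExp (piW fun _ : I => p) (fun x => wExp (piW fun _ : J => q) fun y => F (x i) (y j))
      = wExp p fun a => wExp q fun b => F a b := by
  have h : ∀ x : I → U, wExp (piW fun _ : J => q) (fun y => F (x i) (y j))
      = wExp q fun b => F (x i) b :=
    fun x => wExp_piW_eval (fun _ => hq) j (F (x i))
  simp only [h]
  exact wExp_piW_eval (fun _ => hp) i fun a => wExp q fun b => F a b

/-- Two distinct coordinates of the second family decouple. -/
lemma wExp_pair_mul_le_one {p : U → ℝ} {q : V → ℝ} (hp : IsPMF p) (hq : IsPMF q)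
    {w : U → V → ℝ} (hw0 : ∀ u v, 0 ≤ w u v) (hw : ∀ u, wExp q (w u) ≤ 1)
    (i i' : I) {j j' : J} (hj : j ≠ j') :
    wExp (piW fun _ : I => p) (fun x => wExp (piW fun _ : J => q) fun y =>
      w (x i) (y j) * w (x i') (y j')) ≤ 1 := by
  refine wExp_le_of_le (isPMF_piW fun _ => hp) fun x => ?_
  rw [wExp_piW_resample (fun _ => hq) j]
  have h1 : ∀ y : J → V, wExp q (fun a => w (x i) (Function.update y j a j) *
      w (x i') (Function.update y j a j')) ≤ w (x i') (y j') := by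
    intro y
    simp only [Function.update_self, Function.update_of_ne hj.symm]
    rw [wExp_mul_const]
    exact mul_le_of_le_one_left (hw0 _ _) (hw _)
  refine (wExp_mono (isPMF_piW fun _ => hq) h1).trans ?_
  rw [wExp_piW_eval (fun _ => hq) j' (w (x i'))]
  exact hw _

/-- Probability that no pair from two independent families has positive weight. -/
lemma covering_bound {L₁ L₂ : Type*} [Fintype L₁] [Fintype L₂] [Nonempty L₁] [Nonempty L₂]
    {p : U → ℝ} {q : V → ℝ} (hp : IsPMF p) (hq : IsPMF q)
    {w : U → V → ℝ} (hw0 : ∀ u v, 0 ≤ w u v) (hwq : ∀ u, wExp q (w u) ≤ 1)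
    (hwp : ∀ v, wExp p (fun u => w u v) ≤ 1) {T : ℝ} (hT : 0 ≤ T) (hwT : ∀ u v, w u v ≤ T)
    {φ : L₁ → I} (hφ : φ.Injective) {ψ : L₂ → J} (hψ : ψ.Injective) :
    wExp (piW fun _ : I => p) (fun x => wExp (piW fun _ : J => q) fun y =>
        ind (∀ l₁ l₂, w (x (φ l₁)) (y (ψ l₂)) = 0))
      ≤ 2 * (1 - wExp p fun u => wExp q (w u))
        + T / (Fintype.card L₁ * Fintype.card L₂ : ℝ) := by
  have hP := isPMF_piW (ι := I) fun _ => hp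
  have hQ := isPMF_piW (ι := J) fun _ => hq
  set N : ℝ := Fintype.card L₁ * Fintype.card L₂ with hN
  have hNpos : 0 < N := by
    have h1 : (0 : ℝ) < Fintype.card L₁ := by exact_mod_cast Fintype.card_pos
    have h2 : (0 : ℝ) < Fintype.card L₂ := by exact_mod_cast Fintype.card_pos
    positivity
  let c : (I → U) → (J → V) → L₁ × L₂ → ℝ := fun x y l => w (x (φ l.1)) (y (ψ l.2))
  have hcard : ((Fintype.card (L₁ × L₂) : ℕ) : ℝ) = N := by simp [hN]
  have hpt : ∀ x y, ind (∀ l₁ l₂, w (x (φ l₁)) (y (ψ l₂)) = 0)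
      ≤ 1 - (2 / N) * ∑ l, c x y l + (1 / N ^ 2) * ∑ l, ∑ l', c x y l * c x y l' := by
    intro x y
    have hsq : 1 - (2 / N) * ∑ l, c x y l + (1 / N ^ 2) * ∑ l, ∑ l', c x y l * c x y l'
        = (1 - (1 / N) * ∑ l, c x y l) ^ 2 := by
      rw [← Finset.sum_mul_sum]; field_simp; ring
    rw [hsq]
    by_cases h : ∀ l₁ l₂, w (x (φ l₁)) (y (ψ l₂)) = 0
    · rw [ind_true h]
      have : ∑ l, c x y l = 0 := Finset.sum_eq_zero fun l _ => h _ _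
      simp [this]
    · rw [ind_false h]; positivity
  have hterm : ∀ l l', wExp (piW fun _ : I => p) (fun x => wExp (piW fun _ : J => q) fun y =>
      c x y l * c x y l') ≤ 1 + if l = l' then T else 0 := by
    rintro ⟨l₁, l₂⟩ ⟨l₁', l₂'⟩
    by_cases h2 : l₂ = l₂'
    · by_cases h1 : l₁ = l₁'
      · subst h1 h2
        simp only [if_true]
        have h3 : ∀ x : I → U, ∀ y : J → V,
            c x y (l₁, l₂) * c x y (l₁, l₂) ≤ T * w (x (φ l₁)) (y (ψ l₂)) :=
          fun x y => mul_le_mul_of_nonneg_right (hwT _ _) (hw0 _ _)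
        refine (wExp_mono hP fun x => wExp_mono hQ fun y => h3 x y).trans ?_
        rw [wExp_piW_pair_eq hp hq (fun a b => T * w a b)]
        simp only [wExp_const_mul]
        have : wExp p (fun a => wExp q fun b => w a b) ≤ 1 := wExp_le_of_le hp hwq
        nlinarith
      · have : ((l₁, l₂) : L₁ × L₂) ≠ (l₁', l₂') := by simp [h1]
        rw [if_neg this, add_zero, wExp_comm]
        exact wExp_pair_mul_le_one (w := fun v u => w u v) hq hp (fun _ _ => hw0 _ _) hwp
          (ψ l₂) (ψ l₂') (hφ.ne h1)
    · have : ((l₁, l₂) : L₁ × L₂) ≠ (l₁', l₂') := by simp [h2]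
      rw [if_neg this, add_zero]
      exact wExp_pair_mul_le_one hp hq hw0 hwq (φ l₁) (φ l₁') (hψ.ne h2)
  refine (wExp_mono hP fun x => wExp_mono hQ fun y => hpt x y).trans ?_
  simp only [wExp_add, wExp_sub, wExp_const_mul, wExp_sum, wExp_const hP, wExp_const hQ]
  have e1 : ∀ l, wExp (piW fun _ : I => p) (fun x => wExp (piW fun _ : J => q) fun y => c x y l)
      = wExp p fun u => wExp q (w u) := fun l => wExp_piW_pair_eq hp hq w _ _
  have e2 : ∑ l, ∑ l', wExp (piW fun _ : I => p) (fun x => wExp (piW fun _ : J => q) fun y =>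
      c x y l * c x y l') ≤ N ^ 2 + N * T := by
    refine (Finset.sum_le_sum fun l _ => Finset.sum_le_sum fun l' _ => hterm l l').trans ?_
    simp only [Finset.sum_add_distrib, Finset.sum_ite_eq, Finset.mem_univ, if_true,
      Finset.sum_const, Finset.card_univ, nsmul_eq_mul, mul_one, hcard]
    exact le_of_eq (by ring)
  simp only [e1, Finset.sum_const, Finset.card_univ, nsmul_eq_mul, hcard]
  have e3 : 1 / N ^ 2 * ∑ l, ∑ l', wExp (piW fun _ : I => p)
      (fun x => wExp (piW fun _ : J => q) fun y => c x y l * c x y l')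
      ≤ 1 / N ^ 2 * (N ^ 2 + N * T) := mul_le_mul_of_nonneg_left e2 (by positivity)
  have e4 : 1 / N ^ 2 * (N ^ 2 + N * T) = 1 + T / N := by field_simp
  have e5 : ∀ g : ℝ, 2 / N * (N * g) = 2 * g := fun g => by field_simp
  rw [e5]
  linarith

end Covering

end BCFB

namespace BCFB

/-! ### One-shot Marton coding bound -/

section OneShot

variable {U₀ U₁ U₂ Y Z₁ Z₂ C K₁ K₂ L₁ L₂ M : Type*}

/-- A cloud: a centre together with its two families of satellites. -/
abbrev Cloud (U₀ U₁ U₂ I J : Type*) : Type _ := U₀ × (I → U₁) × (J → U₂)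

/-- Choose a pair of satellite indices landing in `G`, if there is one. -/
def pickPair [Nonempty L₁] [Nonempty L₂] (G : U₀ → U₁ → U₂ → Prop) (u : U₀)
    (s₁ : L₁ → U₁) (s₂ : L₂ → U₂) : L₁ × L₂ :=
  if h : ∃ l : L₁ × L₂, G u (s₁ l.1) (s₂ l.2) then h.choose
  else (Classical.arbitrary L₁, Classical.arbitrary L₂)

lemma pickPair_spec [Nonempty L₁] [Nonempty L₂] {G : U₀ → U₁ → U₂ → Prop} {u : U₀}
    {s₁ : L₁ → U₁} {s₂ : L₂ → U₂} (h : ∃ l : L₁ × L₂, G u (s₁ l.1) (s₂ l.2)) :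
    G u (s₁ (pickPair G u s₁ s₂).1) (s₂ (pickPair G u s₁ s₂).2) := by
  unfold pickPair
  rw [dif_pos h]
  exact h.choose_spec

/-- The codeword triple transmitted from a cloud for satellite messages `k₁`, `k₂`. -/
def cloudEnc [Nonempty L₁] [Nonempty L₂] (G : U₀ → U₁ → U₂ → Prop)
    (x : Cloud U₀ U₁ U₂ (K₁ × L₁) (K₂ × L₂)) (k₁ : K₁) (k₂ : K₂) : U₀ × U₁ × U₂ :=
  let l := pickPair G x.1 (fun l => x.2.1 (k₁, l)) fun l => x.2.2 (k₂, l)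
  (x.1, x.2.1 (k₁, l.1), x.2.2 (k₂, l.2))

/-- Joint decoder for a cloud index and a satellite message. -/
def jointDec {A B D K L Z : Type*} [Nonempty (D × K)] (T : A → B → Z → Prop)
    (u : D → A) (v : D → K × L → B) (z : Z) : D × K :=
  if h : ∃ m : D × K, ∃ l, T (u m.1) (v m.1 (m.2, l)) z then h.choose
  else Classical.arbitrary _

lemma jointDec_ne {A B D K L Z : Type*} [Nonempty (D × K)] {T : A → B → Z → Prop}
    {u : D → A} {v : D → K × L → B} {z : Z} {c : D} {k : K} {l : L}
    (h : jointDec T u v z ≠ (c, k)) :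
    ¬ T (u c) (v c (k, l)) z ∨ (∃ k', k' ≠ k ∧ ∃ l, T (u c) (v c (k', l)) z) ∨
      ∃ c', c' ≠ c ∧ ∃ i, T (u c') (v c' i) z := by
  by_contra! hc
  obtain ⟨h1, h2, h3⟩ := hc
  have hex : ∃ m : D × K, ∃ l, T (u m.1) (v m.1 (m.2, l)) z := ⟨(c, k), l, h1⟩
  apply h
  unfold jointDec
  rw [dif_pos hex]
  obtain ⟨l', hl'⟩ := hex.choose_spec
  have e1 : hex.choose.1 = c := by
    by_contra hne
    exact h3 _ hne _ hl'
  have e2 : hex.choose.2 = k := by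
    by_contra hne
    rw [e1] at hl'
    exact h2 _ hne _ hl'
  exact Prod.ext e1 e2

variable
  [Fintype U₀] [Fintype U₁] [Fintype U₂] [Fintype Y]
  [Fintype C] [Fintype K₁] [Fintype K₂] [Fintype L₁] [Fintype L₂] [Fintype M]

/-- The distribution of a random cloud. -/
def cloudW {I J : Type*} [Fintype I] [Fintype J]
    (p₀ : U₀ → ℝ) (k₁ : U₀ → U₁ → ℝ) (k₂ : U₀ → U₂ → ℝ) (x : Cloud U₀ U₁ U₂ I J) : ℝ :=
  p₀ x.1 * (piW (fun _ => k₁ x.1) x.2.1 * piW (fun _ => k₂ x.1) x.2.2)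

lemma wExp_cloudW {I J : Type*} [Fintype I] [Fintype J] [DecidableEq I] [DecidableEq J]
    (p₀ : U₀ → ℝ) (k₁ : U₀ → U₁ → ℝ) (k₂ : U₀ → U₂ → ℝ) (F : Cloud U₀ U₁ U₂ I J → ℝ) :
    wExp (cloudW p₀ k₁ k₂) F = wExp p₀ fun u => wExp (piW fun _ : I => k₁ u) fun v₁ =>
      wExp (piW fun _ : J => k₂ u) fun v₂ => F (u, v₁, v₂) := by
  simp only [wExp, cloudW, Fintype.sum_prod_type, Finset.mul_sum]
  exact Finset.sum_congr rfl fun _ _ => Finset.sum_congr rfl fun _ _ =>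
    Finset.sum_congr rfl fun _ _ => by ring

lemma isPMF_cloudW {I J : Type*} [Fintype I] [Fintype J] [DecidableEq I] [DecidableEq J]
    {p₀ : U₀ → ℝ} {k₁ : U₀ → U₁ → ℝ} {k₂ : U₀ → U₂ → ℝ}
    (h₀ : IsPMF p₀) (h₁ : IsKernel k₁) (h₂ : IsKernel k₂) :
    IsPMF (cloudW p₀ k₁ k₂ : Cloud U₀ U₁ U₂ I J → ℝ) := by
  refine ⟨fun x => mul_nonneg (h₀.1 _) (mul_nonneg ((isPMF_piW fun _ => h₁ _).1 _)
    ((isPMF_piW fun _ => h₂ _).1 _)), ?_⟩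
  have h := wExp_cloudW (I := I) (J := J) p₀ k₁ k₂ fun _ => 1
  simp only [wExp_const (isPMF_piW fun _ => h₁ _), wExp_const (isPMF_piW fun _ => h₂ _),
    wExp_const h₀] at h
  simpa [wExp] using h

variable [DecidableEq K₁] [DecidableEq K₂] [DecidableEq L₁] [DecidableEq L₂] [DecidableEq C]

/-- Random coding: probability that no jointly good satellite pair exists in a cloud. -/
lemma wExp_cloud_fail_le [Nonempty L₁] [Nonempty L₂]
    {p₀ : U₀ → ℝ} {k₁ : U₀ → U₁ → ℝ} {k₂ : U₀ → U₂ → ℝ}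
    (h₀ : IsPMF p₀) (h₁ : IsKernel k₁) (h₂ : IsKernel k₂)
    {w : U₀ → U₁ → U₂ → ℝ} (hw0 : ∀ a b c, 0 ≤ w a b c)
    (hw2 : ∀ a b, wExp (k₂ a) (w a b) ≤ 1) (hw1 : ∀ a c, wExp (k₁ a) (fun b => w a b c) ≤ 1)
    {T : ℝ} (hT : 0 ≤ T) {G : U₀ → U₁ → U₂ → Prop} (hG : ∀ a b c, G a b c → w a b c ≤ T)
    {γ : ℝ} (hγ : 1 - γ ≤ wExp p₀ fun a => wExp (k₁ a) fun b => wExp (k₂ a) fun c =>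
      w a b c * ind (G a b c)) (m₁ : K₁) (m₂ : K₂) :
    wExp (cloudW p₀ k₁ k₂) (fun x : Cloud U₀ U₁ U₂ (K₁ × L₁) (K₂ × L₂) =>
        ind (¬ ∃ l : L₁ × L₂, G x.1 (x.2.1 (m₁, l.1)) (x.2.2 (m₂, l.2))))
      ≤ 2 * γ + T / (Fintype.card L₁ * Fintype.card L₂ : ℝ) := by
  rw [wExp_cloudW]
  have hle : ∀ a b c, w a b c * ind (G a b c) ≤ w a b c := fun a b c =>
    mul_le_of_le_one_right (hw0 _ _ _) (ind_le_one _)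
  have key : ∀ a, wExp (piW fun _ : K₁ × L₁ => k₁ a) (fun v₁ =>
      wExp (piW fun _ : K₂ × L₂ => k₂ a) fun v₂ =>
        ind (¬ ∃ l : L₁ × L₂, G a (v₁ (m₁, l.1)) (v₂ (m₂, l.2))))
      ≤ 2 * (1 - wExp (k₁ a) fun b => wExp (k₂ a) fun c => w a b c * ind (G a b c))
        + T / (Fintype.card L₁ * Fintype.card L₂ : ℝ) := by
    intro a
    refine le_trans ?_ (covering_bound (h₁ a) (h₂ a)
      (w := fun b c => w a b c * ind (G a b c))
      (fun b c => mul_nonneg (hw0 _ _ _) (ind_nonneg _))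
      (fun b => (wExp_mono (h₂ a) (hle a b)).trans (hw2 a b))
      (fun c => (wExp_mono (h₁ a) fun b => hle a b c).trans (hw1 a c)) hT ?_
      (φ := fun l : L₁ => (m₁, l)) (ψ := fun l : L₂ => (m₂, l))
      (fun _ _ h => (Prod.mk.inj h).2) (fun _ _ h => (Prod.mk.inj h).2))
    · refine wExp_mono (isPMF_piW fun _ => h₁ a) fun v₁ =>
        wExp_mono (isPMF_piW fun _ => h₂ a) fun v₂ => ind_mono fun h l₁ l₂ => ?_
      rw [ind_false fun hg => h ⟨(l₁, l₂), hg⟩, mul_zero]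
    · intro b c
      by_cases hg : G a b c
      · exact (hle a b c).trans (hG a b c hg)
      · simpa [ind_false hg] using hT
  refine (wExp_mono h₀ key).trans ?_
  simp only [wExp_add, wExp_const_mul, wExp_sub, wExp_const h₀]
  linarith

/-- A sum over all elements other than `k` of a constant bound. -/
lemma sum_ne_le {κ : Type*} [Fintype κ] [DecidableEq κ] (k : κ) {F : κ → ℝ} {q : ℝ}
    (h : ∀ k' ≠ k, F k' ≤ q) :
    ∑ k' ∈ Finset.univ.erase k, F k' ≤ (Fintype.card κ - 1 : ℝ) * q := by
  refine (Finset.sum_le_card_nsmul _ _ q fun k' hk' => h k' (Finset.ne_of_mem_erase hk')).trans_eq ?_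
  have : 1 ≤ Fintype.card κ := Fintype.card_pos_iff.2 ⟨k⟩
  rw [Finset.card_erase_of_mem (Finset.mem_univ _), Finset.card_univ, nsmul_eq_mul,
    Nat.cast_sub this, Nat.cast_one]

/-- Union bound over wrong satellite messages in one family of satellites. `x` is the transmitted
triple, which only depends on the satellites carrying message `m`. -/
lemma wExp_wrong_satellite_le {K L B S : Type*} [Fintype K] [Fintype L] [Fintype B]
    [DecidableEq K] [DecidableEq L]
    {k : B → ℝ} (hk : IsPMF k) {V : S → Y → ℝ} (hV : ∀ s, IsPMF (V s))
    {T : B → Y → Prop} {q : ℝ} (hq : ∀ y, wExp k (fun b => ind (T b y)) ≤ q) (m : K)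
    (s : (K × L → B) → S)
    (hs : ∀ v v', (∀ l, v (m, l) = v' (m, l)) → s v = s v') :
    wExp (piW fun _ : K × L => k) (fun v => wExp (V (s v)) fun y =>
        ind (∃ m', m' ≠ m ∧ ∃ l, T (v (m', l)) y))
      ≤ (Fintype.card K - 1 : ℝ) * (Fintype.card L * q) := by
  have hP := isPMF_piW (ι := K × L) fun _ => hk
  have h1 : ∀ (v : K × L → B) y, ind (∃ m', m' ≠ m ∧ ∃ l, T (v (m', l)) y)
      ≤ ∑ m' ∈ Finset.univ.erase m, ∑ l, ind (T (v (m', l)) y) := by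
    intro v y
    refine le_trans ?_ (Finset.sum_le_sum fun m' _ =>
      ind_exists_le Finset.univ fun l => T (v (m', l)) y)
    refine le_trans (ind_mono ?_) (ind_exists_le _ _)
    rintro ⟨m', hm, l, hT⟩
    exact ⟨m', Finset.mem_erase.2 ⟨hm, Finset.mem_univ _⟩, l, Finset.mem_univ _, hT⟩
  refine (wExp_mono hP fun v => wExp_mono (hV _) (h1 v)).trans ?_
  simp only [wExp_sum]
  refine sum_ne_le m fun m' hm => ?_
  rw [← nsmul_eq_mul, ← Finset.card_univ]
  refine Finset.sum_le_card_nsmul _ _ _ fun l _ => ?_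
  rw [wExp_piW_resample (fun _ => hk) (m', l)]
  refine wExp_le_of_le hP fun v => ?_
  have h2 : ∀ a, s (Function.update v (m', l) a) = s v := fun a => hs _ _ fun l' =>
    Function.update_of_ne (fun h => hm (Prod.mk.inj h).1.symm) _ _
  simp only [h2, Function.update_self]
  rw [wExp_comm]
  exact wExp_le_of_le (hV _) hq

/-- One-shot Marton bound with superposition coding, mutual covering and joint decoding. -/
theorem one_shot_marton [Nonempty L₁] [Nonempty L₂]
    {p₀ : U₀ → ℝ} {k₁ : U₀ → U₁ → ℝ} {k₂ : U₀ → U₂ → ℝ}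
    (h₀ : IsPMF p₀) (h₁ : IsKernel k₁) (h₂ : IsKernel k₂)
    {w : U₀ → U₁ → U₂ → ℝ} (hw0 : ∀ a b c, 0 ≤ w a b c)
    (hw2 : ∀ a b, wExp (k₂ a) (w a b) ≤ 1) (hw1 : ∀ a c, wExp (k₁ a) (fun b => w a b c) ≤ 1)
    {T : ℝ} (hT : 0 ≤ T) {G : U₀ → U₁ → U₂ → Prop} (hG : ∀ a b c, G a b c → w a b c ≤ T)
    {γ : ℝ} (hγ : 1 - γ ≤ wExp p₀ fun a => wExp (k₁ a) fun b => wExp (k₂ a) fun c =>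
      w a b c * ind (G a b c))
    {V : U₀ × U₁ × U₂ → Y → ℝ} (hV : IsKernel V) (π₁ : Y → Z₁) (π₂ : Y → Z₂)
    {T₁ : U₀ → U₁ → Z₁ → Prop} {T₂ : U₀ → U₂ → Z₂ → Prop} {ε : ℝ} (hε : 0 ≤ ε)
    (hGV : ∀ a b c, G a b c →
      wExp (V (a, b, c)) (fun y => ind (¬ T₁ a b (π₁ y) ∨ ¬ T₂ a c (π₂ y))) ≤ ε)
    {q₁ q₂ η₁ η₂ : ℝ} (hq₁ : ∀ a z, wExp (k₁ a) (fun b => ind (T₁ a b z)) ≤ q₁)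
    (hq₂ : ∀ a z, wExp (k₂ a) (fun b => ind (T₂ a b z)) ≤ q₂)
    (hη₁ : ∀ z, wExp p₀ (fun a => wExp (piW fun _ : K₁ × L₁ => k₁ a) fun v =>
      ind (∃ i, T₁ a (v i) z)) ≤ η₁)
    (hη₂ : ∀ z, wExp p₀ (fun a => wExp (piW fun _ : K₂ × L₂ => k₂ a) fun v =>
      ind (∃ i, T₂ a (v i) z)) ≤ η₂)
    [Nonempty C] [Nonempty K₁] [Nonempty K₂] (φ : M → C × K₁ × K₂) :
    ∃ (enc : M → U₀ × U₁ × U₂) (dec₁ : Z₁ → C × K₁) (dec₂ : Z₂ → C × K₂),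
      ∑ m, wExp (V (enc m)) (fun y => ind (dec₁ (π₁ y) ≠ ((φ m).1, (φ m).2.1) ∨
          dec₂ (π₂ y) ≠ ((φ m).1, (φ m).2.2)))
        ≤ Fintype.card M * (2 * γ + T / (Fintype.card L₁ * Fintype.card L₂ : ℝ) + ε
          + (Fintype.card K₁ - 1 : ℝ) * (Fintype.card L₁ * q₁)
          + (Fintype.card K₂ - 1 : ℝ) * (Fintype.card L₂ * q₂)
          + (Fintype.card C - 1 : ℝ) * η₁ + (Fintype.card C - 1 : ℝ) * η₂) := by
  let Q : Cloud U₀ U₁ U₂ (K₁ × L₁) (K₂ × L₂) → ℝ := cloudW p₀ k₁ k₂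
  have hQ : IsPMF Q := isPMF_cloudW h₀ h₁ h₂
  let P : (C → Cloud U₀ U₁ U₂ (K₁ × L₁) (K₂ × L₂)) → ℝ := piW fun _ => Q
  have hP : IsPMF P := isPMF_piW fun _ => hQ
  let encF (b : C → Cloud U₀ U₁ U₂ (K₁ × L₁) (K₂ × L₂)) (m : M) : U₀ × U₁ × U₂ :=
    cloudEnc G (b (φ m).1) (φ m).2.1 (φ m).2.2
  let d₁ (b : C → Cloud U₀ U₁ U₂ (K₁ × L₁) (K₂ × L₂)) : Z₁ → C × K₁ :=
    jointDec T₁ (fun c => (b c).1) fun c => (b c).2.1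
  let d₂ (b : C → Cloud U₀ U₁ U₂ (K₁ × L₁) (K₂ × L₂)) : Z₂ → C × K₂ :=
    jointDec T₂ (fun c => (b c).1) fun c => (b c).2.2
  suffices hmain : ∀ m, wExp P (fun b => wExp (V (encF b m)) (fun y =>
      ind (d₁ b (π₁ y) ≠ ((φ m).1, (φ m).2.1) ∨ d₂ b (π₂ y) ≠ ((φ m).1, (φ m).2.2))))
      ≤ 2 * γ + T / (Fintype.card L₁ * Fintype.card L₂ : ℝ) + ε
          + (Fintype.card K₁ - 1 : ℝ) * (Fintype.card L₁ * q₁)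
          + (Fintype.card K₂ - 1 : ℝ) * (Fintype.card L₂ * q₂)
          + (Fintype.card C - 1 : ℝ) * η₁ + (Fintype.card C - 1 : ℝ) * η₂ by
    obtain ⟨b, hb⟩ := exists_le_wExp hP fun b => ∑ m, wExp (V (encF b m)) (fun y =>
      ind (d₁ b (π₁ y) ≠ ((φ m).1, (φ m).2.1) ∨ d₂ b (π₂ y) ≠ ((φ m).1, (φ m).2.2)))
    refine ⟨encF b, d₁ b, d₂ b, hb.trans ?_⟩
    rw [wExp_sum, ← nsmul_eq_mul, ← Finset.card_univ]
    exact Finset.sum_le_card_nsmul _ _ _ fun m _ => hmain m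
  intro m
  rcases hφm : φ m with ⟨c, m₁, m₂⟩
  have hpt : ∀ b : C → Cloud U₀ U₁ U₂ (K₁ × L₁) (K₂ × L₂),
      wExp (V (encF b m)) (fun y => ind (d₁ b (π₁ y) ≠ (c, m₁) ∨ d₂ b (π₂ y) ≠ (c, m₂)))
      ≤ ind (¬ ∃ l : L₁ × L₂, G (b c).1 ((b c).2.1 (m₁, l.1)) ((b c).2.2 (m₂, l.2))) + ε
        + wExp (V (cloudEnc G (b c) m₁ m₂)) (fun y => ind (∃ k, k ≠ m₁ ∧ ∃ l,
            T₁ (b c).1 ((b c).2.1 (k, l)) (π₁ y)))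
        + wExp (V (cloudEnc G (b c) m₁ m₂)) (fun y => ind (∃ k, k ≠ m₂ ∧ ∃ l,
            T₂ (b c).1 ((b c).2.2 (k, l)) (π₂ y)))
        + ∑ c' ∈ Finset.univ.erase c, wExp (V (cloudEnc G (b c) m₁ m₂))
            (fun y => ind (∃ i, T₁ (b c').1 ((b c').2.1 i) (π₁ y)))
        + ∑ c' ∈ Finset.univ.erase c, wExp (V (cloudEnc G (b c) m₁ m₂))
            (fun y => ind (∃ i, T₂ (b c').1 ((b c').2.2 i) (π₂ y))) := by
    intro b
    have henc : encF b m = cloudEnc G (b c) m₁ m₂ := by simp only [encF, hφm]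
    rw [henc]
    set x := cloudEnc G (b c) m₁ m₂ with hx
    have hx1 : x.1 = (b c).1 := rfl
    let l := pickPair G (b c).1 (fun l => (b c).2.1 (m₁, l)) fun l => (b c).2.2 (m₂, l)
    have hx2 : x.2.1 = (b c).2.1 (m₁, l.1) := rfl
    have hx3 : x.2.2 = (b c).2.2 (m₂, l.2) := rfl
    have hy : ∀ y, ind (d₁ b (π₁ y) ≠ (c, m₁) ∨ d₂ b (π₂ y) ≠ (c, m₂))
        ≤ ind (¬ T₁ x.1 x.2.1 (π₁ y) ∨ ¬ T₂ x.1 x.2.2 (π₂ y))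
          + ind (∃ k, k ≠ m₁ ∧ ∃ l, T₁ (b c).1 ((b c).2.1 (k, l)) (π₁ y))
          + ind (∃ k, k ≠ m₂ ∧ ∃ l, T₂ (b c).1 ((b c).2.2 (k, l)) (π₂ y))
          + ∑ c' ∈ Finset.univ.erase c, ind (∃ i, T₁ (b c').1 ((b c').2.1 i) (π₁ y))
          + ∑ c' ∈ Finset.univ.erase c, ind (∃ i, T₂ (b c').1 ((b c').2.2 i) (π₂ y)) := by
      intro y
      have s1 := ind_exists_le (Finset.univ.erase c)
        fun c' => ∃ i, T₁ (b c').1 ((b c').2.1 i) (π₁ y)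
      have s2 := ind_exists_le (Finset.univ.erase c)
        fun c' => ∃ i, T₂ (b c').1 ((b c').2.2 i) (π₂ y)
      refine le_trans ?_ (add_le_add (add_le_add le_rfl s1) s2)
      refine le_trans ?_ ((ind_or_le _ _).trans (add_le_add_left ((ind_or_le _ _).trans
        (add_le_add_left ((ind_or_le _ _).trans (add_le_add_left (ind_or_le _ _) _)) _)) _))
      refine ind_mono ?_
      rintro (h | h)
      · rcases jointDec_ne (l := l.1) h with h | h | ⟨c', hc, h⟩
        · exact Or.inl (Or.inl (Or.inl (Or.inl (Or.inl h))))
        · exact Or.inl (Or.inl (Or.inl (Or.inr h)))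
        · exact Or.inl (Or.inr ⟨c', Finset.mem_erase.2 ⟨hc, Finset.mem_univ _⟩, h⟩)
      · rcases jointDec_ne (l := l.2) h with h | h | ⟨c', hc, h⟩
        · exact Or.inl (Or.inl (Or.inl (Or.inl (Or.inr h))))
        · exact Or.inl (Or.inl (Or.inr h))
        · exact Or.inr ⟨c', Finset.mem_erase.2 ⟨hc, Finset.mem_univ _⟩, h⟩
    refine (wExp_mono (hV x) hy).trans ?_
    simp only [wExp_add, wExp_sum]
    gcongr
    by_cases hex : ∃ l : L₁ × L₂, G (b c).1 ((b c).2.1 (m₁, l.1)) ((b c).2.2 (m₂, l.2))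
    · rw [ind_false (not_not.2 hex), zero_add]
      exact hGV _ _ _ (pickPair_spec (s₁ := fun l => (b c).2.1 (m₁, l))
        (s₂ := fun l => (b c).2.2 (m₂, l)) hex)
    · rw [ind_true hex]
      have := wExp_le_of_le (hV x) (F := fun y => ind (¬ T₁ x.1 x.2.1 (π₁ y) ∨
        ¬ T₂ x.1 x.2.2 (π₂ y))) fun y => ind_le_one _
      linarith
  refine (wExp_mono hP hpt).trans ?_
  simp only [wExp_add, wExp_sum, wExp_const hP]
  have hsel : ∀ F : Cloud U₀ U₁ U₂ (K₁ × L₁) (K₂ × L₂) → ℝ,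
      wExp P (fun b => F (b c)) = wExp Q F := fun F => wExp_piW_eval (fun _ => hQ) c F
  have hwrong : ∀ c' ≠ c, ∀ (B : Cloud U₀ U₁ U₂ (K₁ × L₁) (K₂ × L₂) → Y → Prop) (η : ℝ),
      (∀ y, wExp Q (fun x => ind (B x y)) ≤ η) →
      wExp P (fun b => wExp (V (cloudEnc G (b c) m₁ m₂)) fun y => ind (B (b c') y)) ≤ η := by
    intro c' hc B η hB
    change wExp (piW fun _ => Q) _ ≤ _
    rw [wExp_piW_resample (fun _ => hQ) c']
    refine wExp_le_of_le hP fun b => ?_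
    simp only [Function.update_self, Function.update_of_ne hc.symm]
    rw [wExp_comm]
    exact wExp_le_of_le (hV _) hB
  have e1 := wExp_cloud_fail_le (L₁ := L₁) (L₂ := L₂) h₀ h₁ h₂ hw0 hw2 hw1 hT hG hγ m₁ m₂
  have e2 : wExp P (fun b => wExp (V (cloudEnc G (b c) m₁ m₂)) (fun y => ind (∃ k, k ≠ m₁ ∧ ∃ l,
            T₁ (b c).1 ((b c).2.1 (k, l)) (π₁ y))))
      ≤ (Fintype.card K₁ - 1 : ℝ) * (Fintype.card L₁ * q₁) := by
    rw [hsel fun x => wExp (V (cloudEnc G x m₁ m₂)) (fun y => ind (∃ k, k ≠ m₁ ∧ ∃ l,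
            T₁ x.1 (x.2.1 (k, l)) (π₁ y))), wExp_cloudW]
    refine wExp_le_of_le h₀ fun a => ?_
    rw [wExp_comm]
    refine wExp_le_of_le (isPMF_piW fun _ => h₂ a) fun v₂ => ?_
    refine wExp_wrong_satellite_le (h₁ a) hV (T := fun b y => T₁ a b (π₁ y))
      (fun y => hq₁ a _) m₁ (fun v₁ => cloudEnc G (a, v₁, v₂) m₁ m₂) fun v v' h => ?_
    simp only [cloudEnc, h]
  have e3 : wExp P (fun b => wExp (V (cloudEnc G (b c) m₁ m₂)) (fun y => ind (∃ k, k ≠ m₂ ∧ ∃ l,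
            T₂ (b c).1 ((b c).2.2 (k, l)) (π₂ y))))
      ≤ (Fintype.card K₂ - 1 : ℝ) * (Fintype.card L₂ * q₂) := by
    rw [hsel fun x => wExp (V (cloudEnc G x m₁ m₂)) (fun y => ind (∃ k, k ≠ m₂ ∧ ∃ l,
            T₂ x.1 (x.2.2 (k, l)) (π₂ y))), wExp_cloudW]
    refine wExp_le_of_le h₀ fun a => ?_
    refine wExp_le_of_le (isPMF_piW fun _ => h₁ a) fun v₁ => ?_
    refine wExp_wrong_satellite_le (h₂ a) hV (T := fun b y => T₂ a b (π₂ y))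
      (fun y => hq₂ a _) m₂ (fun v₂ => cloudEnc G (a, v₁, v₂) m₁ m₂) fun v v' h => ?_
    simp only [cloudEnc, h]
  have e4 := sum_ne_le c (F := fun c' => wExp P (fun b => wExp (V (cloudEnc G (b c) m₁ m₂))
      fun y => ind (∃ i, T₁ (b c').1 ((b c').2.1 i) (π₁ y)))) fun c' hc =>
    hwrong c' hc (fun x y => ∃ i, T₁ x.1 (x.2.1 i) (π₁ y)) η₁ fun y => by
      rw [wExp_cloudW]
      simpa only [wExp_const (isPMF_piW fun _ => h₂ _)] using hη₁ (π₁ y)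
  have e5 := sum_ne_le c (F := fun c' => wExp P (fun b => wExp (V (cloudEnc G (b c) m₁ m₂))
      fun y => ind (∃ i, T₂ (b c').1 ((b c').2.2 i) (π₂ y)))) fun c' hc =>
    hwrong c' hc (fun x y => ∃ i, T₂ x.1 (x.2.2 i) (π₂ y)) η₂ fun y => by
      rw [wExp_cloudW]
      simpa only [wExp_const (isPMF_piW fun _ => h₁ _)] using hη₂ (π₂ y)
  rw [hsel fun x => ind (¬ ∃ l : L₁ × L₂, G x.1 (x.2.1 (m₁, l.1)) (x.2.2 (m₂, l.2)))]
  gcongr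

end OneShot

end BCFB

namespace BCFB

/-! ### Information densities -/

section Densities

variable {Ω A B C : Type*} [Fintype Ω] {w : Ω → ℝ}

lemma distOf_eq_wExp (w : Ω → ℝ) (X : Ω → A) (a : A) :
    distOf w X a = wExp w fun ω => ind (X ω = a) := by
  simp only [distOf, prOf, wExp, ind, mul_ite, mul_one, mul_zero]

lemma distOf_nonneg (hw : ∀ ω, 0 ≤ w ω) (X : Ω → A) (a : A) : 0 ≤ distOf w X a :=
  Finset.sum_nonneg fun ω _ => by split_ifs <;> simp [hw ω]

lemma le_distOf (hw : ∀ ω, 0 ≤ w ω) (X : Ω → A) (ω : Ω) : w ω ≤ distOf w X (X ω) := by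
  have h := Finset.single_le_sum (f := fun ω' => if X ω' = X ω then w ω' else 0)
    (fun ω' _ => by split_ifs <;> simp [hw ω']) (Finset.mem_univ ω)
  simpa [distOf, prOf] using h

lemma distOf_pos (hw : ∀ ω, 0 ≤ w ω) (X : Ω → A) {ω : Ω} (h : w ω ≠ 0) :
    0 < distOf w X (X ω) :=
  (lt_of_le_of_ne (hw ω) h.symm).trans_le (le_distOf hw X ω)

lemma wExp_distOf [Fintype A] (w : Ω → ℝ) (X : Ω → A) (g : A → ℝ) :
    wExp (distOf w X) g = wExp w fun ω => g (X ω) := by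
  simp only [wExp, distOf, prOf, Finset.sum_mul]
  rw [Finset.sum_comm]
  refine Finset.sum_congr rfl fun ω _ => ?_
  simp [ite_mul]

lemma isPMF_distOf [Fintype A] (hw : IsPMF w) (X : Ω → A) : IsPMF (distOf w X) :=
  ⟨distOf_nonneg hw.1 X, by simpa [wExp, hw.2] using wExp_distOf w X fun _ => 1⟩

lemma sum_distOf_pair [Fintype A] (w : Ω → ℝ) (X : Ω → A) (Z : Ω → C) (z : C) :
    ∑ x, distOf w (fun ω => (X ω, Z ω)) (x, z) = distOf w Z z := by
  simp only [distOf, prOf, Prod.mk.injEq]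
  rw [Finset.sum_comm]
  refine Finset.sum_congr rfl fun ω _ => ?_
  by_cases h : Z ω = z <;> simp [h]

lemma distOf_mono_of_imp (hw : ∀ ω, 0 ≤ w ω) {X : Ω → A} {Y : Ω → B} {a : A} {b : B}
    (h : ∀ ω, X ω = a → Y ω = b) : distOf w X a ≤ distOf w Y b := by
  refine Finset.sum_le_sum fun ω _ => ?_
  by_cases hX : X ω = a
  · rw [if_pos hX, if_pos (h ω hX)]
  · rw [if_neg hX]; split_ifs <;> simp [hw ω]

lemma distOf_congr (w : Ω → ℝ) {X : Ω → A} {Y : Ω → B} {a : A} {b : B}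
    (h : ∀ ω, X ω = a ↔ Y ω = b) : distOf w X a = distOf w Y b := by
  simp only [distOf, prOf, h]

lemma entOf_eq_wExp [Fintype A] (w : Ω → ℝ) (X : Ω → A) :
    entOf w X = -wExp w fun ω => Real.logb 2 (distOf w X (X ω)) := by
  rw [← wExp_distOf w X fun a => Real.logb 2 (distOf w X a)]
  rfl

lemma entOf_relabel [Fintype A] [Fintype B] (w : Ω → ℝ) (X : Ω → A) (Y : Ω → B)
    (h : ∀ ω ω', X ω' = X ω ↔ Y ω' = Y ω) : entOf w X = entOf w Y := by
  rw [entOf_eq_wExp, entOf_eq_wExp]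
  simp only [distOf_congr w (h _)]

/-- Conditional law of `X` given `Z`, with an arbitrary choice on null events. -/
def condW (w : Ω → ℝ) (X : Ω → A) (Z : Ω → C) (z : C) (x : A) : ℝ :=
  if distOf w Z z = 0 then distOf w X x
  else distOf w (fun ω => (X ω, Z ω)) (x, z) / distOf w Z z

/-- Ratio whose logarithm is the information density of `X` and `Y`. -/
def infoRatio (w : Ω → ℝ) (X : Ω → A) (Y : Ω → B) (x : A) (y : B) : ℝ :=
  distOf w (fun ω => (X ω, Y ω)) (x, y) / (distOf w X x * distOf w Y y)

/-- Ratio whose logarithm is the conditional information density of `X` and `Y` given `Z`. -/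
def condInfoRatio (w : Ω → ℝ) (X : Ω → A) (Y : Ω → B) (Z : Ω → C) (x : A) (y : B) (z : C) : ℝ :=
  distOf w (fun ω => (X ω, Y ω, Z ω)) (x, y, z) * distOf w Z z /
    (distOf w (fun ω => (X ω, Z ω)) (x, z) * distOf w (fun ω => (Y ω, Z ω)) (y, z))

lemma isKernel_condW [Fintype A] [Fintype C] (hw : IsPMF w) (X : Ω → A) (Z : Ω → C) :
    IsKernel (condW w X Z) := by
  intro z
  by_cases hz : distOf w Z z = 0
  · have : condW w X Z z = distOf w X := funext fun x => if_pos hz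
    rw [this]
    exact isPMF_distOf hw X
  · have : condW w X Z z = fun x => distOf w (fun ω => (X ω, Z ω)) (x, z) / distOf w Z z :=
      funext fun x => if_neg hz
    rw [this]
    refine ⟨fun x => div_nonneg (distOf_nonneg hw.1 _ _) (distOf_nonneg hw.1 _ _), ?_⟩
    rw [← Finset.sum_div, sum_distOf_pair, div_self hz]

lemma distOf_pair_eq_zero (hw : ∀ ω, 0 ≤ w ω) (X : Ω → A) {Z : Ω → C} (x : A) {z : C}
    (hz : distOf w Z z = 0) : distOf w (fun ω => (X ω, Z ω)) (x, z) = 0 :=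
  le_antisymm (hz ▸ distOf_mono_of_imp hw fun _ h => (Prod.mk.inj h).2) (distOf_nonneg hw _ _)

lemma distOf_mul_condW (hw : ∀ ω, 0 ≤ w ω) (X : Ω → A) (Z : Ω → C) (x : A) (z : C) :
    distOf w Z z * condW w X Z z x = distOf w (fun ω => (X ω, Z ω)) (x, z) := by
  unfold condW
  split_ifs with hz
  · rw [hz, zero_mul, distOf_pair_eq_zero hw X x hz]
  · field_simp

lemma infoRatio_nonneg (hw : ∀ ω, 0 ≤ w ω) (X : Ω → A) (Y : Ω → B) (x : A) (y : B) :
    0 ≤ infoRatio w X Y x y :=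
  div_nonneg (distOf_nonneg hw _ _) (mul_nonneg (distOf_nonneg hw _ _) (distOf_nonneg hw _ _))

lemma condInfoRatio_nonneg (hw : ∀ ω, 0 ≤ w ω) (X : Ω → A) (Y : Ω → B) (Z : Ω → C)
    (x : A) (y : B) (z : C) : 0 ≤ condInfoRatio w X Y Z x y z :=
  div_nonneg (mul_nonneg (distOf_nonneg hw _ _) (distOf_nonneg hw _ _))
    (mul_nonneg (distOf_nonneg hw _ _) (distOf_nonneg hw _ _))

lemma infoRatio_pos (hw : ∀ ω, 0 ≤ w ω) (X : Ω → A) (Y : Ω → B) {ω : Ω} (h : w ω ≠ 0) :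
    0 < infoRatio w X Y (X ω) (Y ω) :=
  div_pos (distOf_pos hw (fun ω => (X ω, Y ω)) h)
    (mul_pos (distOf_pos hw X h) (distOf_pos hw Y h))

lemma condInfoRatio_pos (hw : ∀ ω, 0 ≤ w ω) (X : Ω → A) (Y : Ω → B) (Z : Ω → C) {ω : Ω}
    (h : w ω ≠ 0) : 0 < condInfoRatio w X Y Z (X ω) (Y ω) (Z ω) :=
  div_pos (mul_pos (distOf_pos hw (fun ω => (X ω, Y ω, Z ω)) h) (distOf_pos hw Z h))
    (mul_pos (distOf_pos hw (fun ω => (X ω, Z ω)) h) (distOf_pos hw (fun ω => (Y ω, Z ω)) h))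

lemma wExp_congr_support {α : Type*} [Fintype α] {v : α → ℝ} {F G : α → ℝ}
    (h : ∀ a, v a ≠ 0 → F a = G a) : wExp v F = wExp v G :=
  Finset.sum_congr rfl fun a _ => by
    by_cases ha : v a = 0
    · simp [ha]
    · rw [h a ha]

lemma wExp_mono_support {α : Type*} [Fintype α] {v : α → ℝ} (hv : ∀ a, 0 ≤ v a) {F G : α → ℝ}
    (h : ∀ a, v a ≠ 0 → F a ≤ G a) : wExp v F ≤ wExp v G :=
  Finset.sum_le_sum fun a _ => by
    by_cases ha : v a = 0
    · simp [ha]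
    · exact mul_le_mul_of_nonneg_left (h a ha) (hv a)

lemma wExp_logb_infoRatio [Fintype A] [Fintype B] (hw : ∀ ω, 0 ≤ w ω) (X : Ω → A) (Y : Ω → B) :
    wExp w (fun ω => Real.logb 2 (infoRatio w X Y (X ω) (Y ω))) = miOf w X Y := by
  have h : ∀ ω, w ω ≠ 0 → Real.logb 2 (infoRatio w X Y (X ω) (Y ω))
      = Real.logb 2 (distOf w (fun ω => (X ω, Y ω)) (X ω, Y ω))
        - Real.logb 2 (distOf w X (X ω)) - Real.logb 2 (distOf w Y (Y ω)) := by
    intro ω hω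
    have h1 := (distOf_pos hw (fun ω => (X ω, Y ω)) hω).ne'
    have h2 := (distOf_pos hw X hω).ne'
    have h3 := (distOf_pos hw Y hω).ne'
    rw [infoRatio, Real.logb_div h1 (mul_ne_zero h2 h3), Real.logb_mul h2 h3]
    ring
  rw [wExp_congr_support h, wExp_sub, wExp_sub, miOf, entOf_eq_wExp, entOf_eq_wExp,
    entOf_eq_wExp]
  ring

lemma wExp_logb_condInfoRatio [Fintype A] [Fintype B] [Fintype C] (hw : ∀ ω, 0 ≤ w ω)
    (X : Ω → A) (Y : Ω → B) (Z : Ω → C) :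
    wExp w (fun ω => Real.logb 2 (condInfoRatio w X Y Z (X ω) (Y ω) (Z ω))) = cmiOf w X Y Z := by
  have h : ∀ ω, w ω ≠ 0 → Real.logb 2 (condInfoRatio w X Y Z (X ω) (Y ω) (Z ω))
      = Real.logb 2 (distOf w (fun ω => (X ω, Y ω, Z ω)) (X ω, Y ω, Z ω))
        + Real.logb 2 (distOf w Z (Z ω))
        - Real.logb 2 (distOf w (fun ω => (X ω, Z ω)) (X ω, Z ω))
        - Real.logb 2 (distOf w (fun ω => (Y ω, Z ω)) (Y ω, Z ω)) := by
    intro ω hω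
    have h1 := (distOf_pos hw (fun ω => (X ω, Y ω, Z ω)) hω).ne'
    have h2 := (distOf_pos hw (fun ω => (X ω, Z ω)) hω).ne'
    have h3 := (distOf_pos hw (fun ω => (Y ω, Z ω)) hω).ne'
    have h4 := (distOf_pos hw Z hω).ne'
    rw [condInfoRatio, Real.logb_div (mul_ne_zero h1 h4) (mul_ne_zero h2 h3),
      Real.logb_mul h2 h3, Real.logb_mul h1 h4]
    ring
  rw [wExp_congr_support h, wExp_sub, wExp_sub, wExp_add, cmiOf, entOf_eq_wExp, entOf_eq_wExp,
    entOf_eq_wExp, entOf_eq_wExp]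
  ring

lemma condInfoRatio_swap (w : Ω → ℝ) (X : Ω → A) (Y : Ω → B) (Z : Ω → C) (x : A) (y : B) (z : C) :
    condInfoRatio w X Y Z x y z = condInfoRatio w Y X Z y x z := by
  unfold condInfoRatio
  rw [distOf_congr w (X := fun ω => (X ω, Y ω, Z ω)) (Y := fun ω => (Y ω, X ω, Z ω))
    (b := (y, x, z)) fun ω => by simp only [Prod.mk.injEq]; tauto]
  ring

lemma wExp_distOf_infoRatio_le_one [Fintype A] (hw : ∀ ω, 0 ≤ w ω) (X : Ω → A) (Y : Ω → B)
    (y : B) : wExp (distOf w X) (fun x => infoRatio w X Y x y) ≤ 1 := by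
  have h : ∀ x, distOf w X x * infoRatio w X Y x y
      ≤ distOf w (fun ω => (X ω, Y ω)) (x, y) / distOf w Y y := by
    intro x
    unfold infoRatio
    by_cases hx : distOf w X x = 0
    · rw [hx, zero_mul]
      exact div_nonneg (distOf_nonneg hw _ _) (distOf_nonneg hw _ _)
    · apply le_of_eq; field_simp
  refine (Finset.sum_le_sum fun x _ => h x).trans ?_
  rw [← Finset.sum_div, sum_distOf_pair]
  exact div_self_le_one _

lemma wExp_condW_condInfoRatio_le_one [Fintype A] (hw : ∀ ω, 0 ≤ w ω) (X : Ω → A) (Y : Ω → B)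
    (Z : Ω → C) (y : B) (z : C) :
    wExp (condW w X Z z) (fun x => condInfoRatio w X Y Z x y z) ≤ 1 := by
  have h : ∀ x, condW w X Z z x * condInfoRatio w X Y Z x y z
      ≤ distOf w (fun ω => (X ω, Y ω, Z ω)) (x, y, z) /
        distOf w (fun ω => (Y ω, Z ω)) (y, z) := by
    intro x
    have hn : 0 ≤ distOf w (fun ω => (X ω, Y ω, Z ω)) (x, y, z) /
        distOf w (fun ω => (Y ω, Z ω)) (y, z) :=
      div_nonneg (distOf_nonneg hw _ _) (distOf_nonneg hw _ _)
    unfold condInfoRatio condW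
    by_cases hz : distOf w Z z = 0
    · simpa [hz] using hn
    · rw [if_neg hz]
      by_cases hx : distOf w (fun ω => (X ω, Z ω)) (x, z) = 0
      · simpa [hx] using hn
      · apply le_of_eq; field_simp
  refine (Finset.sum_le_sum fun x _ => h x).trans ?_
  rw [← Finset.sum_div, sum_distOf_pair w X (fun ω => (Y ω, Z ω)) (y, z)]
  exact div_self_le_one _

lemma distOf_mul_condW_mul_condInfoRatio (hw : ∀ ω, 0 ≤ w ω) (X : Ω → A) (Y : Ω → B)
    (Z : Ω → C) (x : A) (y : B) (z : C) :
    distOf w Z z * (condW w X Z z x * (condW w Y Z z y * condInfoRatio w X Y Z x y z))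
      = distOf w (fun ω => (X ω, Y ω, Z ω)) (x, y, z) := by
  have hle1 : distOf w (fun ω => (X ω, Y ω, Z ω)) (x, y, z)
      ≤ distOf w (fun ω => (X ω, Z ω)) (x, z) :=
    distOf_mono_of_imp hw fun ω h => by simp only [Prod.mk.injEq] at h ⊢; tauto
  have hle2 : distOf w (fun ω => (X ω, Y ω, Z ω)) (x, y, z)
      ≤ distOf w (fun ω => (Y ω, Z ω)) (y, z) :=
    distOf_mono_of_imp hw fun ω h => by simp only [Prod.mk.injEq] at h ⊢; tauto
  have h0 := distOf_nonneg hw (fun ω => (X ω, Y ω, Z ω)) (x, y, z)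
  by_cases hx : distOf w (fun ω => (X ω, Z ω)) (x, z) = 0
  · have : distOf w (fun ω => (X ω, Y ω, Z ω)) (x, y, z) = 0 := by linarith
    simp [condInfoRatio, this]
  by_cases hy : distOf w (fun ω => (Y ω, Z ω)) (y, z) = 0
  · have : distOf w (fun ω => (X ω, Y ω, Z ω)) (x, y, z) = 0 := by linarith
    simp [condInfoRatio, this]
  have hz : distOf w Z z ≠ 0 := fun hz => hx (distOf_pair_eq_zero hw X x hz)
  unfold condW condInfoRatio
  rw [if_neg hz, if_neg hz]
  field_simp

lemma cmiOf_nonneg [Fintype A] [Fintype B] [Fintype C] (hw : IsPMF w) (X : Ω → A) (Y : Ω → B)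
    (Z : Ω → C) : 0 ≤ cmiOf w X Y Z := by
  rw [← wExp_logb_condInfoRatio hw.1]
  let r : A × B × C → ℝ := fun a => condInfoRatio w X Y Z a.1 a.2.1 a.2.2
  have h1 : wExp w (fun ω => (1 - (r (X ω, Y ω, Z ω))⁻¹) / Real.log 2)
      ≤ wExp w (fun ω => Real.logb 2 (condInfoRatio w X Y Z (X ω) (Y ω) (Z ω))) := by
    refine wExp_mono_support hw.1 fun ω hω => ?_
    rw [Real.logb]
    have : 0 < Real.log 2 := Real.log_pos one_lt_two
    gcongr
    exact Real.one_sub_inv_le_log_of_pos (condInfoRatio_pos hw.1 X Y Z hω)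
  refine le_trans ?_ h1
  simp only [div_eq_mul_inv]
  rw [wExp_mul_const, wExp_sub, wExp_const hw]
  refine mul_nonneg (sub_nonneg.2 ?_) (inv_nonneg.2 (Real.log_pos one_lt_two).le)
  rw [← wExp_distOf w (fun ω => (X ω, Y ω, Z ω)) fun a => (r a)⁻¹]
  have h2 : ∀ a : A × B × C, distOf w (fun ω => (X ω, Y ω, Z ω)) a * (r a)⁻¹
      ≤ distOf w Z a.2.2 * (condW w X Z a.2.2 a.1 * condW w Y Z a.2.2 a.2.1) := by
    rintro ⟨x, y, z⟩
    rw [← distOf_mul_condW_mul_condInfoRatio hw.1]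
    by_cases hr : r (x, y, z) = 0
    · rw [hr, inv_zero, mul_zero]
      exact mul_nonneg (distOf_nonneg hw.1 _ _)
        (mul_nonneg ((isKernel_condW hw X Z z).1 x) ((isKernel_condW hw Y Z z).1 y))
    · apply le_of_eq
      change _ * (condW w X Z z x * (condW w Y Z z y * r (x, y, z))) * _ = _
      field_simp
  refine (Finset.sum_le_sum fun a _ => h2 a).trans_eq ?_
  simp only [Fintype.sum_prod_type]
  have h3 : ∀ x : A, ∑ y, ∑ z, distOf w Z z * (condW w X Z z x * condW w Y Z z y)
      = ∑ z, distOf w Z z * condW w X Z z x := by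
    intro x
    rw [Finset.sum_comm]
    refine Finset.sum_congr rfl fun z _ => ?_
    rw [← Finset.mul_sum, ← Finset.mul_sum, (isKernel_condW hw Y Z z).2, mul_one]
  simp only [h3]
  rw [Finset.sum_comm]
  simp only [← Finset.mul_sum, (isKernel_condW hw X Z _).2, mul_one]
  exact (isPMF_distOf hw Z).2

lemma miOf_pair_eq_add [Fintype A] [Fintype B] [Fintype C] (w : Ω → ℝ) (U : Ω → A) (V : Ω → B)
    (Y : Ω → C) : miOf w (fun ω => (U ω, V ω)) Y = miOf w U Y + cmiOf w V Y U := by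
  unfold miOf cmiOf
  rw [entOf_relabel w (fun ω => (V ω, U ω)) (fun ω => (U ω, V ω))
      fun _ _ => by simp only [Prod.mk.injEq]; tauto,
    entOf_relabel w (fun ω => (Y ω, U ω)) (fun ω => (U ω, Y ω))
      fun _ _ => by simp only [Prod.mk.injEq]; tauto,
    entOf_relabel w (fun ω => (V ω, Y ω, U ω)) (fun ω => ((U ω, V ω), Y ω))
      fun _ _ => by simp only [Prod.mk.injEq]; tauto]
  ring

end Densities

/-! ### Weak law of large numbers for product weights -/

section LargeNumbers

variable {Ω : Type*} [Fintype Ω] {w : Ω → ℝ}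

lemma wExp_piW_sq_sum {ι : Type*} [Fintype ι] [DecidableEq ι] (hw : IsPMF w) {g : Ω → ℝ}
    (hg : wExp w g = 0) :
    wExp (piW fun _ : ι => w) (fun ω => (∑ i, g (ω i)) ^ 2)
      = Fintype.card ι * wExp w fun a => g a ^ 2 := by
  have h : ∀ i j, wExp (piW fun _ : ι => w) (fun ω => g (ω i) * g (ω j))
      = if i = j then wExp w (fun a => g a ^ 2) else 0 := by
    intro i j
    split_ifs with hij
    · subst hij
      rw [← wExp_piW_eval (ι := ι) (fun _ => hw) i]
      simp only [sq]
    · rw [wExp_piW_resample (fun _ => hw) i]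
      simp only [Function.update_self, Function.update_of_ne (Ne.symm hij), wExp_mul_const, hg,
        zero_mul]
      exact wExp_const (isPMF_piW fun _ => hw) 0
  simp only [sq (∑ i, g _), Finset.sum_mul_sum, wExp_sum, h]
  simp

/-- The empirical sum rarely falls below `n` times any number less than the mean. -/
lemma tendsto_wExp_sum_lt (hw : IsPMF w) (g : Ω → ℝ) {i : ℝ} (hi : i < wExp w g) :
    Filter.Tendsto (fun n : ℕ => wExp (piW fun _ : Fin n => w)
      fun ω => ind (∑ t, g (ω t) < n * i)) Filter.atTop (nhds 0) := by
  set μ := wExp w g with hμ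
  set v := wExp w (fun a => (g a - μ) ^ 2) with hv
  have hg0 : wExp w (fun a => g a - μ) = 0 := by rw [wExp_sub, wExp_const hw, sub_self]
  have hd : 0 < μ - i := sub_pos.2 hi
  have hb : ∀ n : ℕ, 0 < n → wExp (piW fun _ : Fin n => w)
      (fun ω => ind (∑ t, g (ω t) < n * i)) ≤ v / (μ - i) ^ 2 / n := by
    intro n hn
    have hn' : (0 : ℝ) < n := by exact_mod_cast hn
    have h1 : ∀ ω : Fin n → Ω, ind (∑ t, g (ω t) < n * i)
        ≤ (∑ t, (g (ω t) - μ)) ^ 2 * (n * (μ - i))⁻¹ ^ 2 := by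
      intro ω
      by_cases hlt : ∑ t, g (ω t) < n * i
      · rw [ind_true hlt, ← mul_pow]
        have h2 : ∑ t, (g (ω t) - μ) ≤ -(n * (μ - i)) := by
          simp only [Finset.sum_sub_distrib, Finset.sum_const, Finset.card_univ, Fintype.card_fin,
            nsmul_eq_mul]
          linarith
        have hp : 0 < n * (μ - i) := mul_pos hn' hd
        have h3 : (∑ t, (g (ω t) - μ)) * (n * (μ - i))⁻¹ ≤ -1 := by
          rw [← div_eq_mul_inv, div_le_iff₀ hp]
          linarith
        nlinarith
      · rw [ind_false hlt]; positivity
    refine (wExp_mono (isPMF_piW fun _ => hw) h1).trans_eq ?_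
    rw [wExp_mul_const, wExp_piW_sq_sum hw hg0, Fintype.card_fin, ← hv]
    field_simp
  refine squeeze_zero' (Filter.Eventually.of_forall fun n =>
    wExp_nonneg (isPMF_piW fun _ => hw) fun _ => ind_nonneg _)
    (Filter.eventually_atTop.2 ⟨1, fun n hn => hb n hn⟩) ?_
  exact tendsto_const_div_atTop_nhds_zero_nat _

lemma logb_prod_eq {α : Type*} {w d : α → ℝ} {n : ℕ} (hd : ∀ ω, w ω ≠ 0 → 0 < d ω)
    {ω : Fin n → α}
    (hω : piW (fun _ => w) ω ≠ 0) : ∏ t, d (ω t) = (2 : ℝ) ^ (∑ t, Real.logb 2 (d (ω t))) := by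
  have hpos : ∀ t, 0 < d (ω t) := fun t => hd _ (Finset.prod_ne_zero_iff.1 hω t (Finset.mem_univ _))
  rw [Real.rpow_sum_of_pos two_pos]
  exact Finset.prod_congr rfl fun t _ => (Real.rpow_logb two_pos (by norm_num) (hpos t)).symm

lemma tendsto_wExp_not_rpow_le_prod (hw : IsPMF w) {d : Ω → ℝ} (hd : ∀ ω, w ω ≠ 0 → 0 < d ω)
    {i : ℝ} (hi : i < wExp w fun ω => Real.logb 2 (d ω)) :
    Filter.Tendsto (fun n : ℕ => wExp (piW fun _ : Fin n => w)
      fun ω => ind (¬ (2 : ℝ) ^ (n * i) ≤ ∏ t, d (ω t))) Filter.atTop (nhds 0) := by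
  refine squeeze_zero (fun n => wExp_nonneg (isPMF_piW fun _ => hw) fun _ => ind_nonneg _)
    (fun n => wExp_mono_support (isPMF_piW fun _ => hw).1 fun ω hω => ind_mono fun h => ?_)
    (tendsto_wExp_sum_lt hw _ hi)
  rw [logb_prod_eq hd hω, not_le] at h
  exact (Real.rpow_lt_rpow_left_iff one_lt_two).1 h

lemma tendsto_wExp_not_prod_le_rpow (hw : IsPMF w) {d : Ω → ℝ} (hd : ∀ ω, w ω ≠ 0 → 0 < d ω)
    {i : ℝ} (hi : (wExp w fun ω => Real.logb 2 (d ω)) < i) :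
    Filter.Tendsto (fun n : ℕ => wExp (piW fun _ : Fin n => w)
      fun ω => ind (¬ ∏ t, d (ω t) ≤ (2 : ℝ) ^ (n * i))) Filter.atTop (nhds 0) := by
  have hneg : -i < wExp w fun ω => -Real.logb 2 (d ω) := by
    have : wExp w (fun ω => -Real.logb 2 (d ω)) = -wExp w fun ω => Real.logb 2 (d ω) := by
      simp [wExp]
    rw [this]
    exact neg_lt_neg hi
  refine squeeze_zero (fun n => wExp_nonneg (isPMF_piW fun _ => hw) fun _ => ind_nonneg _)
    (fun n => wExp_mono_support (isPMF_piW fun _ => hw).1 fun ω hω => ind_mono fun h => ?_)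
    (tendsto_wExp_sum_lt hw _ hneg)
  rw [logb_prod_eq hd hω, not_le] at h
  have := (Real.rpow_lt_rpow_left_iff one_lt_two).1 h
  rw [Finset.sum_neg_distrib]
  linarith

end LargeNumbers

end BCFB

namespace BCFB

/-! ### Product weights built from joint laws -/

section Products

variable {A B C Ω : Type*} [Fintype A] [Fintype B] [Fintype C] [Fintype Ω]

lemma wExp_piW_prod {ι : Type*} [Fintype ι] [DecidableEq ι] (q g : ι → A → ℝ) :
    wExp (piW q) (fun f => ∏ i, g i (f i)) = ∏ i, wExp (q i) (g i) := by
  have := sum_piW fun i a => q i a * g i a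
  simpa only [wExp, piW, Finset.prod_mul_distrib] using this

lemma wExp_piW_le_one {ι : Type*} [Fintype ι] [DecidableEq ι] {q g : ι → A → ℝ}
    (hq : ∀ i a, 0 ≤ q i a) (hg : ∀ i a, 0 ≤ g i a) (h : ∀ i, wExp (q i) (g i) ≤ 1) :
    wExp (piW q) (fun f => ∏ i, g i (f i)) ≤ 1 := by
  rw [wExp_piW_prod]
  exact Finset.prod_le_one
    (fun i _ => Finset.sum_nonneg fun a _ => mul_nonneg (hq i a) (hg i a)) fun i _ => h i

/-- Markov's inequality for a nonnegative statistic of mean at most one. -/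
lemma wExp_ind_le_inv {v : A → ℝ} (hv : IsPMF v) {F : A → ℝ} (hF : ∀ a, 0 ≤ F a)
    (h1 : wExp v F ≤ 1) {θ : ℝ} (hθ : 0 < θ) {P : A → Prop} (hP : ∀ a, P a → θ ≤ F a) :
    wExp v (fun a => ind (P a)) ≤ θ⁻¹ := by
  have h : ∀ a, ind (P a) ≤ θ⁻¹ * F a := by
    intro a
    by_cases ha : P a
    · rw [ind_true ha, inv_mul_eq_div, le_div_iff₀ hθ, one_mul]
      exact hP a ha
    · rw [ind_false ha]
      exact mul_nonneg (inv_nonneg.2 hθ.le) (hF a)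
  refine (wExp_mono hv h).trans ?_
  rw [wExp_const_mul]
  exact mul_le_of_le_one_right (inv_nonneg.2 hθ.le) h1

lemma wExp_piW_joint {n : ℕ} {p : A → ℝ} {k : A → B → ℝ} {w : A × B → ℝ}
    (hw : ∀ a b, w (a, b) = p a * k a b) (F : (Fin n → A) → (Fin n → B) → ℝ) :
    wExp (piW fun _ : Fin n => w) (fun z => F (fun t => (z t).1) fun t => (z t).2)
      = wExp (piW fun _ => p) fun a => wExp (piW fun t => k (a t)) fun b => F a b := by
  simp only [wExp, Finset.mul_sum]
  rw [← Fintype.sum_prod_type', ← (Equiv.arrowProdEquivProdArrow (Fin n) (fun _ => A)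
    (fun _ => B)).sum_comp]
  refine Finset.sum_congr rfl fun z _ => ?_
  simp only [Equiv.arrowProdEquivProdArrow, Equiv.coe_fn_mk, piW, ← mul_assoc,
    ← Finset.prod_mul_distrib]
  simp only [← hw]

lemma wExp_piW_distOf {n : ℕ} (w : Ω → ℝ) (X : Ω → A) (F : (Fin n → A) → ℝ) :
    wExp (piW fun _ : Fin n => distOf w X) F
      = wExp (piW fun _ : Fin n => w) fun ω => F fun t => X (ω t) := by
  have h : (piW fun _ : Fin n => distOf w X)
      = distOf (piW fun _ : Fin n => w) fun ω t => X (ω t) := by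
    funext a
    rw [distOf_eq_wExp]
    have := wExp_piW_prod (fun _ : Fin n => w) fun t ω => ind (X ω = a t)
    rw [piW]
    simp only [distOf_eq_wExp]
    rw [← this]
    congr 1
    funext ω
    simp only [ind, funext_iff, Finset.prod_ite_zero, Finset.mem_univ, true_imp_iff,
      Finset.prod_const_one]
  rw [h, wExp_distOf]

lemma wExp_piW_condInfoRatio {n : ℕ} {w : Ω → ℝ} (hw : ∀ ω, 0 ≤ w ω) (X : Ω → A) (Y : Ω → B)
    (Z : Ω → C) (F : (Fin n → C) → (Fin n → A) → (Fin n → B) → ℝ) :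
    (wExp (piW fun _ => distOf w Z) fun z => wExp (piW fun t => condW w X Z (z t)) fun x =>
        wExp (piW fun t => condW w Y Z (z t)) fun y =>
          (∏ t, condInfoRatio w X Y Z (x t) (y t) (z t)) * F z x y)
      = wExp (piW fun _ : Fin n => w)
          fun ω => F (fun t => Z (ω t)) (fun t => X (ω t)) fun t => Y (ω t) := by
  have h1 : ∀ (z : Fin n → C) (x : Fin n → A),
      wExp (piW fun t => condW w Y Z (z t)) (fun y =>
          (∏ t, condInfoRatio w X Y Z (x t) (y t) (z t)) * F z x y)
        = wExp (piW fun t y => condW w Y Z (z t) y * condInfoRatio w X Y Z (x t) y (z t))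
          fun y => F z x y := by
    intro z x
    simp only [wExp, piW, Finset.prod_mul_distrib, mul_assoc]
  simp only [h1]
  rw [← wExp_piW_joint (w := fun a : C × A => distOf w Z a.1 * condW w X Z a.1 a.2)
    (fun _ _ => rfl) fun z x =>
      wExp (piW fun t y => condW w Y Z (z t) y * condInfoRatio w X Y Z (x t) y (z t))
          fun y => F z x y]
  rw [← wExp_piW_joint (w := distOf w fun ω => ((Z ω, X ω), Y ω))
    (k := fun a y => condW w Y Z a.1 y * condInfoRatio w X Y Z a.2 y a.1) ?_
      fun zx y => F (fun t => (zx t).1) (fun t => (zx t).2) y, wExp_piW_distOf]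
  rintro ⟨z, x⟩ y
  rw [mul_assoc, distOf_mul_condW_mul_condInfoRatio hw]
  exact distOf_congr w fun ω => by simp only [Prod.mk.injEq]; tauto

end Products

end BCFB

namespace BCFB

/-! ### Decodability of one receiver -/

section Receiver

variable {Ω A B D : Type*} [Fintype Ω] [Fintype A] [Fintype B] [Fintype D] {w : Ω → ℝ}

lemma tendsto_two_rpow_nat_mul {a : ℝ} (ha : a < 0) :
    Filter.Tendsto (fun n : ℕ => (2 : ℝ) ^ (n * a)) Filter.atTop (nhds 0) := by
  have h : (fun n : ℕ => (2 : ℝ) ^ (n * a)) = fun n : ℕ => ((2 : ℝ) ^ a) ^ n := by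
    funext n
    rw [mul_comm, Real.rpow_mul two_pos.le, Real.rpow_natCast]
  rw [h]
  exact tendsto_pow_atTop_nhds_zero_of_lt_one (Real.rpow_nonneg two_pos.le _)
    (Real.rpow_lt_one_of_one_lt_of_neg one_lt_two ha)

/-- There are decoding tests under which a receiver observing `Y` reliably identifies a satellite
`X₁` (one of `K n` bins of `L n` sequences) together with its centre `X₀` (one of `C n`). -/
def ReceiverOK (w : Ω → ℝ) (X₀ : Ω → A) (X₁ : Ω → B) (Y : Ω → D) (K L C : ℕ → ℕ) : Prop :=
  ∃ (T : ∀ n : ℕ, (Fin n → A) → (Fin n → B) → (Fin n → D) → Prop) (q η : ℕ → ℝ),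
    Filter.Tendsto (fun n => wExp (piW fun _ : Fin n => w) fun ω =>
      ind (¬ T n (fun t => X₀ (ω t)) (fun t => X₁ (ω t)) fun t => Y (ω t)))
        Filter.atTop (nhds 0) ∧
    (∀ n a z, wExp (piW fun t => condW w X₁ X₀ (a t)) (fun b => ind (T n a b z)) ≤ q n) ∧
    (∀ n z, wExp (piW fun _ => distOf w X₀) (fun a =>
      wExp (piW fun _ : Fin (K n) × Fin (L n) => piW fun t => condW w X₁ X₀ (a t)) fun v =>
        ind (∃ i, T n a (v i) z)) ≤ η n) ∧
    Filter.Tendsto (fun n => ((K n : ℝ) - 1) * (L n * q n)) Filter.atTop (nhds 0) ∧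
    Filter.Tendsto (fun n => ((C n : ℝ) - 1) * η n) Filter.atTop (nhds 0)

lemma receiverOK_of_lt (hw : IsPMF w) (X₀ : Ω → A) (X₁ : Ω → B) (Y : Ω → D) {K L C : ℕ → ℕ}
    {r l c : ℝ} (hK1 : ∀ n, 1 ≤ K n) (hC1 : ∀ n, 1 ≤ C n)
    (hK : ∀ n : ℕ, (K n : ℝ) ≤ 2 * 2 ^ (n * r)) (hL : ∀ n : ℕ, (L n : ℝ) ≤ 2 * 2 ^ (n * l))
    (hC : ∀ n : ℕ, (C n : ℝ) ≤ 4 * 2 ^ (n * c)) (h1 : r + l < cmiOf w X₁ Y X₀)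
    (h2 : c + r + l < miOf w (fun ω => (X₀ ω, X₁ ω)) Y) : ReceiverOK w X₀ X₁ Y K L C := by
  obtain ⟨i₁, hi₁, hi₁'⟩ := exists_between h1
  obtain ⟨i₂, hi₂, hi₂'⟩ := exists_between h2
  have hpos : ∀ x : ℝ, (0 : ℝ) < 2 ^ x := Real.rpow_pos_of_pos two_pos
  refine ⟨fun n a b z => 2 ^ (n * i₁) ≤ ∏ t, condInfoRatio w X₁ Y X₀ (b t) (z t) (a t) ∧
      2 ^ (n * i₂) ≤ ∏ t, infoRatio w (fun ω => (X₀ ω, X₁ ω)) Y (a t, b t) (z t),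
    fun n => (2 ^ (n * i₁))⁻¹, fun n => K n * L n * (2 ^ (n * i₂))⁻¹, ?_, ?_, ?_, ?_, ?_⟩
  · have e1 := tendsto_wExp_not_rpow_le_prod hw
      (d := fun ω => condInfoRatio w X₁ Y X₀ (X₁ ω) (Y ω) (X₀ ω))
      (fun ω hω => condInfoRatio_pos hw.1 X₁ Y X₀ hω) (i := i₁)
      (by rwa [wExp_logb_condInfoRatio hw.1])
    have e2 := tendsto_wExp_not_rpow_le_prod hw
      (d := fun ω => infoRatio w (fun ω => (X₀ ω, X₁ ω)) Y (X₀ ω, X₁ ω) (Y ω))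
      (fun ω hω => infoRatio_pos hw.1 (fun ω => (X₀ ω, X₁ ω)) Y hω) (i := i₂)
      (by rwa [wExp_logb_infoRatio hw.1 (fun ω => (X₀ ω, X₁ ω)) Y])
    refine squeeze_zero (fun n => wExp_nonneg (isPMF_piW fun _ => hw) fun _ => ind_nonneg _)
      (fun n => ?_) ((add_zero (0 : ℝ)) ▸ e1.add e2)
    rw [← wExp_add]
    refine wExp_mono (isPMF_piW fun _ => hw) fun ω => ?_
    rw [not_and_or]
    exact ind_or_le _ _
  · intro n a z
    refine wExp_ind_le_inv (isPMF_piW fun t => isKernel_condW hw X₁ X₀ (a t))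
      (F := fun b => ∏ t, condInfoRatio w X₁ Y X₀ (b t) (z t) (a t))
      (fun b => Finset.prod_nonneg fun t _ => condInfoRatio_nonneg hw.1 _ _ _ _ _ _) ?_
      (hpos _) fun b hb => hb.1
    exact wExp_piW_le_one (fun t => (isKernel_condW hw X₁ X₀ (a t)).1)
      (g := fun t b => condInfoRatio w X₁ Y X₀ b (z t) (a t))
      (fun t b => condInfoRatio_nonneg hw.1 _ _ _ _ _ _)
      fun t => wExp_condW_condInfoRatio_le_one hw.1 _ _ _ _ _
  · intro n z
    have hT : ∀ a : Fin n → A, wExp (piW fun _ : Fin (K n) × Fin (L n) =>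
        piW fun t => condW w X₁ X₀ (a t)) (fun v => ind (∃ i,
          2 ^ (n * i₁) ≤ ∏ t, condInfoRatio w X₁ Y X₀ (v i t) (z t) (a t) ∧
          2 ^ (n * i₂) ≤ ∏ t, infoRatio w (fun ω => (X₀ ω, X₁ ω)) Y (a t, v i t) (z t)))
        ≤ K n * L n * wExp (piW fun t => condW w X₁ X₀ (a t)) fun b => ind
          (2 ^ (n * i₂) ≤ ∏ t, infoRatio w (fun ω => (X₀ ω, X₁ ω)) Y (a t, b t) (z t)) := by
      intro a
      have hk := isPMF_piW fun t => isKernel_condW hw X₁ X₀ (a t)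
      refine (wExp_mono (isPMF_piW fun _ => hk) (G := fun v => ∑ i, ind
        (2 ^ (n * i₂) ≤ ∏ t, infoRatio w (fun ω => (X₀ ω, X₁ ω)) Y (a t, v i t) (z t)))
        fun v => ?_).trans_eq ?_
      · refine (ind_mono ?_).trans (ind_exists_le Finset.univ _)
        rintro ⟨i, hi⟩
        exact ⟨i, Finset.mem_univ _, hi.2⟩
      · rw [wExp_sum]
        simp only [wExp_piW_eval (fun _ => hk) _ fun b => ind
          (2 ^ (n * i₂) ≤ ∏ t, infoRatio w (fun ω => (X₀ ω, X₁ ω)) Y (a t, b t) (z t))]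
        simp
    have hp := isPMF_piW (ι := Fin n) fun _ => isPMF_distOf hw X₀
    refine (wExp_mono hp hT).trans ?_
    rw [wExp_const_mul]
    refine mul_le_mul_of_nonneg_left ?_ (by positivity)
    rw [← wExp_piW_joint (w := distOf w fun ω => (X₀ ω, X₁ ω)) ?_ fun a b => ind
      (2 ^ (n * i₂) ≤ ∏ t, infoRatio w (fun ω => (X₀ ω, X₁ ω)) Y (a t, b t) (z t))]
    · refine wExp_ind_le_inv (isPMF_piW fun t => isPMF_distOf hw fun ω => (X₀ ω, X₁ ω))
        (F := fun x => ∏ t, infoRatio w (fun ω => (X₀ ω, X₁ ω)) Y (x t) (z t))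
        (fun b => Finset.prod_nonneg fun t _ => infoRatio_nonneg hw.1 _ _ _ _) ?_
        (hpos _) fun b hb => hb
      exact wExp_piW_le_one (fun t => (isPMF_distOf hw _).1)
        (g := fun t x => infoRatio w (fun ω => (X₀ ω, X₁ ω)) Y x (z t))
        (fun t b => infoRatio_nonneg hw.1 _ _ _ _)
        fun t => wExp_distOf_infoRatio_le_one hw.1 _ _ _
    · intro a b
      rw [distOf_mul_condW hw.1]
      exact distOf_congr w fun ω => by simp only [Prod.mk.injEq]; tauto
  · refine squeeze_zero (g := fun n : ℕ => 4 * 2 ^ (n * (r + l - i₁)))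
      (fun n => mul_nonneg (sub_nonneg.2 (by exact_mod_cast hK1 n)) (by positivity)) (fun n => ?_)
      (by simpa using (tendsto_two_rpow_nat_mul (a := r + l - i₁) (by linarith)).const_mul 4)
    have e : (2 : ℝ) ^ (n * (r + l - i₁)) = 2 ^ (n * r) * 2 ^ (n * l) * (2 ^ (n * i₁))⁻¹ := by
      rw [← Real.rpow_neg two_pos.le, ← Real.rpow_add two_pos, ← Real.rpow_add two_pos]
      ring_nf
    calc ((K n : ℝ) - 1) * (L n * (2 ^ (n * i₁))⁻¹)
        ≤ (2 * 2 ^ (n * r)) * ((2 * 2 ^ (n * l)) * (2 ^ (n * i₁))⁻¹) := by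
          gcongr
          · linarith [hK n]
          · exact hL n
      _ = 4 * 2 ^ (n * (r + l - i₁)) := by rw [e]; ring
  · refine squeeze_zero (g := fun n : ℕ => 16 * 2 ^ (n * (c + r + l - i₂)))
      (fun n => mul_nonneg (sub_nonneg.2 (by exact_mod_cast hC1 n)) (by positivity)) (fun n => ?_)
      (by simpa using (tendsto_two_rpow_nat_mul (a := c + r + l - i₂) (by linarith)).const_mul 16)
    have e : (2 : ℝ) ^ (n * (c + r + l - i₂))
        = 2 ^ (n * c) * 2 ^ (n * r) * 2 ^ (n * l) * (2 ^ (n * i₂))⁻¹ := by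
      rw [← Real.rpow_neg two_pos.le, ← Real.rpow_add two_pos, ← Real.rpow_add two_pos,
        ← Real.rpow_add two_pos]
      ring_nf
    calc ((C n : ℝ) - 1) * (K n * L n * (2 ^ (n * i₂))⁻¹)
        ≤ (4 * 2 ^ (n * c)) * ((2 * 2 ^ (n * r)) * (2 * 2 ^ (n * l)) * (2 ^ (n * i₂))⁻¹) := by
          gcongr
          · linarith [hC n]
          · exact hK n
          · exact hL n
      _ = 16 * 2 ^ (n * (c + r + l - i₂)) := by rw [e]; ring

/-- A receiver whose private bin is trivial can decode the centre alone. -/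
lemma receiverOK_of_lt_center (hw : IsPMF w) (X₀ : Ω → A) (X₁ : Ω → B) (Y : Ω → D)
    {K L C : ℕ → ℕ} {c : ℝ} (hK : ∀ n, K n = 1) (hC1 : ∀ n, 1 ≤ C n)
    (hC : ∀ n : ℕ, (C n : ℝ) ≤ 4 * 2 ^ (n * c)) (h : c < miOf w X₀ Y) :
    ReceiverOK w X₀ X₁ Y K L C := by
  obtain ⟨i₀, hi₀, hi₀'⟩ := exists_between h
  have hpos : ∀ x : ℝ, (0 : ℝ) < 2 ^ x := Real.rpow_pos_of_pos two_pos
  refine ⟨fun n a _ z => 2 ^ (n * i₀) ≤ ∏ t, infoRatio w X₀ Y (a t) (z t),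
    fun _ => 1, fun n => (2 ^ (n * i₀))⁻¹, ?_, ?_, ?_, ?_, ?_⟩
  · exact tendsto_wExp_not_rpow_le_prod hw (d := fun ω => infoRatio w X₀ Y (X₀ ω) (Y ω))
      (fun ω hω => infoRatio_pos hw.1 X₀ Y hω) (by rwa [wExp_logb_infoRatio hw.1])
  · intro n a z
    exact wExp_le_of_le (isPMF_piW fun t => isKernel_condW hw X₁ X₀ (a t)) fun _ => ind_le_one _
  · intro n z
    have hp := isPMF_piW (ι := Fin n) fun _ => isPMF_distOf hw X₀
    refine le_trans (wExp_mono hp (G := fun a => ind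
      (2 ^ (n * i₀) ≤ ∏ t, infoRatio w X₀ Y (a t) (z t))) fun a => ?_) ?_
    · exact wExp_le_of_le (isPMF_piW fun _ => isPMF_piW fun t => isKernel_condW hw X₁ X₀ (a t))
        fun v => ind_mono fun ⟨_, hi⟩ => hi
    · refine wExp_ind_le_inv hp (F := fun x => ∏ t, infoRatio w X₀ Y (x t) (z t))
        (fun b => Finset.prod_nonneg fun t _ => infoRatio_nonneg hw.1 _ _ _ _) ?_
        (hpos _) fun b hb => hb
      exact wExp_piW_le_one (fun t => (isPMF_distOf hw _).1)
        (g := fun t x => infoRatio w X₀ Y x (z t))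
        (fun t b => infoRatio_nonneg hw.1 _ _ _ _)
        fun t => wExp_distOf_infoRatio_le_one hw.1 _ _ _
  · simp [hK]
  · refine squeeze_zero (g := fun n : ℕ => 4 * 2 ^ (n * (c - i₀)))
      (fun n => mul_nonneg (sub_nonneg.2 (by exact_mod_cast hC1 n)) (by positivity)) (fun n => ?_)
      (by simpa using (tendsto_two_rpow_nat_mul (a := c - i₀) (by linarith)).const_mul 4)
    have e : (2 : ℝ) ^ (n * (c - i₀)) = 2 ^ (n * c) * (2 ^ (n * i₀))⁻¹ := by
      rw [← Real.rpow_neg two_pos.le, ← Real.rpow_add two_pos]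
      ring_nf
    rw [e, ← mul_assoc]
    gcongr
    linarith [hC n]

end Receiver

end BCFB

namespace BCFB

/-! ### Asymptotic coding theorem with abstract bin sizes -/

section Coding

variable {U₀ U₁ U₂ Y₁ Y₂ : Type*} [Fintype U₀] [Fintype U₁] [Fintype U₂] [Fintype Y₁] [Fintype Y₂]

lemma isPMF_joint {A B : Type*} [Fintype A] [Fintype B] {p : A → ℝ} {k : A → B → ℝ}
    (hp : IsPMF p) (hk : IsKernel k) : IsPMF fun z : A × B => p z.1 * k z.1 z.2 := by
  refine ⟨fun z => mul_nonneg (hp.1 _) ((hk _).1 _), ?_⟩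
  rw [Fintype.sum_prod_type]
  simp only [← Finset.mul_sum, (hk _).2, mul_one, hp.2]

lemma eventually_exists_code {p : U₀ × U₁ × U₂ → ℝ} (hp : IsPMF p)
    {V : U₀ × U₁ × U₂ → Y₁ × Y₂ → ℝ} (hV : IsKernel V)
    {w : (U₀ × U₁ × U₂) × Y₁ × Y₂ → ℝ} (hw : w = fun z => p z.1 * V z.1 z.2)
    {K₁ K₂ L₁ L₂ C : ℕ → ℕ} (hK₁ : ∀ n, 1 ≤ K₁ n) (hK₂ : ∀ n, 1 ≤ K₂ n) (hL₁ : ∀ n, 1 ≤ L₁ n)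
    (hL₂ : ∀ n, 1 ≤ L₂ n) (hC : ∀ n, 1 ≤ C n)
    (h₁ : ReceiverOK w (fun z => z.1.1) (fun z => z.1.2.1) (fun z => z.2.1) K₁ L₁ C)
    (h₂ : ReceiverOK w (fun z => z.1.1) (fun z => z.1.2.2) (fun z => z.2.2) K₂ L₂ C)
    {i : ℝ} (hi : cmiOf w (fun z => z.1.2.1) (fun z => z.1.2.2) (fun z => z.1.1) < i)
    (hL : Filter.Tendsto (fun n : ℕ => (2 : ℝ) ^ (n * i) / (L₁ n * L₂ n)) Filter.atTop (nhds 0))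
    {ε : ℝ} (hε : 0 < ε) :
    ∀ᶠ n in Filter.atTop, ∀ (M : Type) [Fintype M] (φ : M → Fin (C n) × Fin (K₁ n) × Fin (K₂ n)),
      ∃ (enc : M → Fin n → U₀ × U₁ × U₂) (dec₁ : (Fin n → Y₁) → Fin (C n) × Fin (K₁ n))
        (dec₂ : (Fin n → Y₂) → Fin (C n) × Fin (K₂ n)),
        ∑ m, wExp (piW fun t => V (enc m t)) (fun y =>
          ind (dec₁ (fun t => (y t).1) ≠ ((φ m).1, (φ m).2.1) ∨
            dec₂ (fun t => (y t).2) ≠ ((φ m).1, (φ m).2.2))) ≤ Fintype.card M * ε := by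
  have hwP : IsPMF w := hw ▸ isPMF_joint hp hV
  obtain ⟨T₁, q₁, η₁, hT₁, hq₁, hη₁, hKq₁, hCη₁⟩ := h₁
  obtain ⟨T₂, q₂, η₂, hT₂, hq₂, hη₂, hKq₂, hCη₂⟩ := h₂
  have hr := tendsto_wExp_not_prod_le_rpow hwP
    (d := fun z => condInfoRatio w (fun z => z.1.2.1) (fun z => z.1.2.2) (fun z => z.1.1)
      z.1.2.1 z.1.2.2 z.1.1) (i := i)
    (fun z hz => condInfoRatio_pos hwP.1 (fun z => z.1.2.1) (fun z => z.1.2.2)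
      (fun z => z.1.1) hz)
    (by rwa [wExp_logb_condInfoRatio hwP.1 (fun z => z.1.2.1) (fun z => z.1.2.2)
      (fun z => z.1.1)])
  set R : U₁ → U₂ → U₀ → ℝ :=
    condInfoRatio w (fun z => z.1.2.1) (fun z => z.1.2.2) (fun z => z.1.1) with hR
  have hR0 : ∀ b c a, 0 ≤ R b c a := condInfoRatio_nonneg hwP.1 _ _ _
  have hpos : ∀ x : ℝ, (0 : ℝ) < 2 ^ x := Real.rpow_pos_of_pos two_pos
  have hγ := (hr.add ((hT₁.add hT₂).div_const (ε / 2))).const_mul 2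
  have hlim := ((((hγ.add hL).add_const (ε / 2)).add hKq₁).add hKq₂).add hCη₁ |>.add hCη₂
  have hlt := hlim.eventually_lt_const (u := ε) (by
    simp only [add_zero, zero_div, mul_zero, zero_add]; exact half_lt_self hε)
  filter_upwards [hlt] with n hn M _ φ
  let bad : (Fin n → U₀) → (Fin n → U₁) → (Fin n → U₂) → ℝ := fun a b c =>
    wExp (piW fun t => V (a t, b t, c t)) fun y =>
      ind (¬ T₁ n a b (fun t => (y t).1) ∨ ¬ T₂ n a c fun t => (y t).2)
  have hVn : ∀ u : Fin n → U₀ × U₁ × U₂, IsPMF (piW fun t => V (u t)) :=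
    fun u => isPMF_piW fun t => hV _
  have hbad0 : ∀ a b c, 0 ≤ bad a b c := fun a b c =>
    wExp_nonneg (hVn fun t => (a t, b t, c t)) fun _ => ind_nonneg _
  let G : (Fin n → U₀) → (Fin n → U₁) → (Fin n → U₂) → Prop := fun a b c =>
    ∏ t, R (b t) (c t) (a t) ≤ 2 ^ (n * i) ∧ bad a b c ≤ ε / 2
  have hwn : IsPMF (piW fun _ : Fin n => w) := isPMF_piW fun _ => hwP
  have hjoint : ∀ F : (Fin n → U₀ × U₁ × U₂) → (Fin n → Y₁ × Y₂) → ℝ,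
      wExp (piW fun _ : Fin n => w) (fun z => F (fun t => (z t).1) fun t => (z t).2)
        = wExp (piW fun _ => p) fun u => wExp (piW fun t => V (u t)) fun y => F u y :=
    fun F => wExp_piW_joint (fun u y => by rw [hw]) F
  have hbadE : wExp (piW fun _ : Fin n => w) (fun z =>
        bad (fun t => (z t).1.1) (fun t => (z t).1.2.1) fun t => (z t).1.2.2)
      ≤ wExp (piW fun _ : Fin n => w) (fun z => ind (¬ T₁ n (fun t => (z t).1.1)
          (fun t => (z t).1.2.1) fun t => (z t).2.1))
        + wExp (piW fun _ : Fin n => w) (fun z => ind (¬ T₂ n (fun t => (z t).1.1)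
          (fun t => (z t).1.2.2) fun t => (z t).2.2)) := by
    have e1 := hjoint fun u _ => bad (fun t => (u t).1) (fun t => (u t).2.1) fun t => (u t).2.2
    have e2 := hjoint fun u y => ind (¬ T₁ n (fun t => (u t).1) (fun t => (u t).2.1)
      (fun t => (y t).1) ∨ ¬ T₂ n (fun t => (u t).1) (fun t => (u t).2.2) fun t => (y t).2)
    simp only [wExp_const (hVn _)] at e1
    rw [e1, ← wExp_add]
    refine e2.symm.trans_le (wExp_mono hwn fun z => ind_or_le _ _)
  have hgood : 1 - (wExp (piW fun _ : Fin n => w) (fun z =>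
        ind (¬ ∏ t, R (z t).1.2.1 (z t).1.2.2 (z t).1.1 ≤ 2 ^ (n * i)))
      + (wExp (piW fun _ : Fin n => w) (fun z => ind (¬ T₁ n (fun t => (z t).1.1)
          (fun t => (z t).1.2.1) fun t => (z t).2.1))
        + wExp (piW fun _ : Fin n => w) (fun z => ind (¬ T₂ n (fun t => (z t).1.1)
          (fun t => (z t).1.2.2) fun t => (z t).2.2))) / (ε / 2))
      ≤ wExp (piW fun _ : Fin n => w) fun z =>
          ind (G (fun t => (z t).1.1) (fun t => (z t).1.2.1) fun t => (z t).1.2.2) := by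
    have hpt : ∀ z : Fin n → (U₀ × U₁ × U₂) × Y₁ × Y₂,
        1 - (ind (¬ ∏ t, R (z t).1.2.1 (z t).1.2.2 (z t).1.1 ≤ 2 ^ (n * i))
          + bad (fun t => (z t).1.1) (fun t => (z t).1.2.1) (fun t => (z t).1.2.2) * (ε / 2)⁻¹)
        ≤ ind (G (fun t => (z t).1.1) (fun t => (z t).1.2.1) fun t => (z t).1.2.2) := by
      intro z
      have hb := mul_nonneg (hbad0 (fun t => (z t).1.1) (fun t => (z t).1.2.1)
        fun t => (z t).1.2.2) (inv_nonneg.2 (half_pos hε).le)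
      by_cases hz : ∏ t, R (z t).1.2.1 (z t).1.2.2 (z t).1.1 ≤ 2 ^ (n * i)
      · by_cases hz' : bad (fun t => (z t).1.1) (fun t => (z t).1.2.1) (fun t => (z t).1.2.2)
            ≤ ε / 2
        · rw [ind_true (P := G _ _ _) ⟨hz, hz'⟩]
          linarith [ind_nonneg (¬ ∏ t, R (z t).1.2.1 (z t).1.2.2 (z t).1.1 ≤ 2 ^ (n * i))]
        · have : 1 ≤ bad (fun t => (z t).1.1) (fun t => (z t).1.2.1) (fun t => (z t).1.2.2)
              * (ε / 2)⁻¹ := by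
            rw [← div_eq_mul_inv, one_le_div (half_pos hε)]
            exact (not_le.1 hz').le
          linarith [ind_nonneg (¬ ∏ t, R (z t).1.2.1 (z t).1.2.2 (z t).1.1 ≤ 2 ^ (n * i)),
            ind_nonneg (G (fun t => (z t).1.1) (fun t => (z t).1.2.1) fun t => (z t).1.2.2)]
      · rw [ind_true hz]
        linarith [ind_nonneg (G (fun t => (z t).1.1) (fun t => (z t).1.2.1)
          fun t => (z t).1.2.2)]
    refine le_trans ?_ (wExp_mono hwn hpt)
    rw [wExp_sub, wExp_const hwn, wExp_add, wExp_mul_const, div_eq_mul_inv]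
    gcongr
  have : Nonempty (Fin (L₁ n)) := ⟨⟨0, hL₁ n⟩⟩
  have : Nonempty (Fin (L₂ n)) := ⟨⟨0, hL₂ n⟩⟩
  have : Nonempty (Fin (K₁ n)) := ⟨⟨0, hK₁ n⟩⟩
  have : Nonempty (Fin (K₂ n)) := ⟨⟨0, hK₂ n⟩⟩
  have : Nonempty (Fin (C n)) := ⟨⟨0, hC n⟩⟩
  obtain ⟨enc, dec₁, dec₂, h⟩ := one_shot_marton (L₁ := Fin (L₁ n)) (L₂ := Fin (L₂ n))
    (p₀ := piW fun _ : Fin n => distOf w fun z => z.1.1)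
    (k₁ := fun a => piW fun t => condW w (fun z => z.1.2.1) (fun z => z.1.1) (a t))
    (k₂ := fun a => piW fun t => condW w (fun z => z.1.2.2) (fun z => z.1.1) (a t))
    (isPMF_piW fun _ => isPMF_distOf hwP _) (fun a => isPMF_piW fun t => isKernel_condW hwP _ _ _)
    (fun a => isPMF_piW fun t => isKernel_condW hwP _ _ _)
    (w := fun a b c => ∏ t, R (b t) (c t) (a t))
    (fun a b c => Finset.prod_nonneg fun t _ => hR0 _ _ _)
    (fun a b => wExp_piW_le_one (fun t => (isKernel_condW hwP _ _ _).1)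
      (g := fun t c => R (b t) c (a t)) (fun t c => hR0 _ _ _) fun t => by
        simp only [hR]
        simp only [condInfoRatio_swap w (fun z => z.1.2.1)]
        exact wExp_condW_condInfoRatio_le_one hwP.1 _ _ _ _ _)
    (fun a c => wExp_piW_le_one (fun t => (isKernel_condW hwP _ _ _).1)
      (g := fun t b => R b (c t) (a t)) (fun t c => hR0 _ _ _) fun t =>
        wExp_condW_condInfoRatio_le_one hwP.1 _ _ _ _ _)
    (hpos (n * i)).le (G := G) (fun a b c h => h.1)
    (hgood.trans_eq (wExp_piW_condInfoRatio hwP.1 (fun z => z.1.2.1) (fun z => z.1.2.2)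
      (fun z => z.1.1) fun a b c => ind (G a b c)).symm)
    (V := fun u => piW fun t => V (u.1 t, u.2.1 t, u.2.2 t))
    (fun u => hVn fun t => (u.1 t, u.2.1 t, u.2.2 t))
    (fun y t => (y t).1) (fun y t => (y t).2) (T₁ := T₁ n) (T₂ := T₂ n) (half_pos hε).le
    (fun a b c h => h.2) (hq₁ n) (hq₂ n) (hη₁ n) (hη₂ n) φ
  refine ⟨fun m t => ((enc m).1 t, (enc m).2.1 t, (enc m).2.2 t), dec₁, dec₂, h.trans ?_⟩
  refine mul_le_mul_of_nonneg_left ?_ (Nat.cast_nonneg _)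
  simp only [Fintype.card_fin]
  exact hn.le

end Coding

end BCFB

namespace BCFB

/-! ### From bin indices to messages -/

section Messages

variable {X Y1 Y2 : Type*} [Fintype Y1] [Fintype Y2] {W : X → Y1 × Y2 → ℝ}

lemma errProbNoFB_eq (W : X → Y1 × Y2 → ℝ) (n : ℕ) (R0 R1 R2 : ℝ)
    (enc : Fin (msgCard n R0) × Fin (msgCard n R1) × Fin (msgCard n R2) → Fin n → X)
    (dec1 : (Fin n → Y1) → Fin (msgCard n R0) × Fin (msgCard n R1))
    (dec2 : (Fin n → Y2) → Fin (msgCard n R0) × Fin (msgCard n R2)) :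
    errProbNoFB W n R0 R1 R2 enc dec1 dec2
      = (1 / ((msgCard n R0 : ℝ) * (msgCard n R1 : ℝ) * (msgCard n R2 : ℝ))) *
        ∑ m, wExp (piW fun t => W (enc m t)) fun y => ind (dec1 (fun t => (y t).1) ≠ (m.1, m.2.1) ∨
          dec2 (fun t => (y t).2) ≠ (m.1, m.2.2)) := by
  unfold errProbNoFB wExp piW ind
  congr! 6

lemma one_le_msgCard (n : ℕ) {R : ℝ} (hR : 0 ≤ R) : 1 ≤ msgCard n R :=
  Nat.one_le_floor_iff _ |>.2 (Real.one_le_rpow one_le_two (by positivity))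

lemma msgCard_le (n : ℕ) (R : ℝ) : (msgCard n R : ℝ) ≤ 2 ^ (n * R) :=
  Nat.floor_le (Real.rpow_nonneg two_pos.le _)

lemma achievableNoFB_of_eventually [Fintype X] [Nonempty X] (hW : IsKernel W) {R0 R1 R2 : ℝ} (h0 : 0 ≤ R0)
    (h1 : 0 ≤ R1) (h2 : 0 ≤ R2)
    (h : ∀ ε : ℝ, 0 < ε → ∀ᶠ n in Filter.atTop, ∃ enc dec1 dec2,
      errProbNoFB W n R0 R1 R2 enc dec1 dec2 ≤ ε) : AchievableNoFB W R0 R1 R2 := by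
  have hmin : ∀ n, ∃ enc dec1 dec2, ∀ enc' dec1' dec2',
      errProbNoFB W n R0 R1 R2 enc dec1 dec2 ≤ errProbNoFB W n R0 R1 R2 enc' dec1' dec2' := by
    intro n
    have : Nonempty (Fin (msgCard n R0)) := ⟨⟨0, one_le_msgCard n h0⟩⟩
    have : Nonempty (Fin (msgCard n R1)) := ⟨⟨0, one_le_msgCard n h1⟩⟩
    have : Nonempty (Fin (msgCard n R2)) := ⟨⟨0, one_le_msgCard n h2⟩⟩
    obtain ⟨⟨enc, dec1, dec2⟩, hc⟩ := Finite.exists_min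
      fun c : (Fin (msgCard n R0) × Fin (msgCard n R1) × Fin (msgCard n R2) → Fin n → X) ×
          ((Fin n → Y1) → Fin (msgCard n R0) × Fin (msgCard n R1)) ×
          ((Fin n → Y2) → Fin (msgCard n R0) × Fin (msgCard n R2)) =>
        errProbNoFB W n R0 R1 R2 c.1 c.2.1 c.2.2
    exact ⟨enc, dec1, dec2, fun enc' dec1' dec2' => hc (enc', dec1', dec2')⟩
  choose enc dec1 dec2 hc using hmin
  refine ⟨h0, h1, h2, enc, dec1, dec2, ?_⟩
  have hnn : ∀ n, 0 ≤ errProbNoFB W n R0 R1 R2 (enc n) (dec1 n) (dec2 n) := by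
    intro n
    rw [errProbNoFB_eq]
    exact mul_nonneg (by positivity) (Finset.sum_nonneg fun m _ =>
      wExp_nonneg (isPMF_piW fun t => hW _) fun _ => ind_nonneg _)
  rw [Metric.tendsto_nhds]
  intro ε hε
  filter_upwards [h (ε / 2) (half_pos hε)] with n hn
  obtain ⟨enc', dec1', dec2', hn⟩ := hn
  rw [Real.dist_0_eq_abs, abs_of_nonneg (hnn n)]
  exact ((hc n enc' dec1' dec2').trans hn).trans_lt (half_lt_self hε)

/-- Relabel a code for (cloud index, bin, bin) triples as a code for message triples. -/
lemma exists_code_of_splitting [Fintype X] (hW : IsKernel W) {n : ℕ} {R0 R1 R2 : ℝ} (h0 : 0 ≤ R0) (h1 : 0 ≤ R1)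
    (h2 : 0 ≤ R2) {C₁ C₂ K₁ K₂ : ℕ} (hm₁ : msgCard n R1 ≤ C₁ * K₁) (hm₂ : msgCard n R2 ≤ C₂ * K₂)
    {ε : ℝ} (h : ∀ (M : Type) [Fintype M]
        (φ : M → Fin (msgCard n R0 * C₁ * C₂) × Fin K₁ × Fin K₂),
      ∃ (enc : M → Fin n → X) (dec₁ : (Fin n → Y1) → Fin (msgCard n R0 * C₁ * C₂) × Fin K₁)
        (dec₂ : (Fin n → Y2) → Fin (msgCard n R0 * C₁ * C₂) × Fin K₂),
        ∑ m, wExp (piW fun t => W (enc m t)) (fun y =>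
          ind (dec₁ (fun t => (y t).1) ≠ ((φ m).1, (φ m).2.1) ∨
            dec₂ (fun t => (y t).2) ≠ ((φ m).1, (φ m).2.2))) ≤ Fintype.card M * ε) :
    ∃ enc dec1 dec2, errProbNoFB W n R0 R1 R2 enc dec1 dec2 ≤ ε := by
  have : Nonempty (Fin (msgCard n R1)) := ⟨⟨0, one_le_msgCard n h1⟩⟩
  have : Nonempty (Fin (msgCard n R2)) := ⟨⟨0, one_le_msgCard n h2⟩⟩
  obtain ⟨g⟩ : Nonempty (Fin (msgCard n R0) × Fin C₁ × Fin C₂ ≃ Fin (msgCard n R0 * C₁ * C₂)) :=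
    ⟨Fintype.equivOfCardEq (by simp [mul_assoc])⟩
  obtain ⟨e₁⟩ : Nonempty (Fin (msgCard n R1) ↪ Fin C₁ × Fin K₁) :=
    Function.Embedding.nonempty_of_card_le (by simpa using hm₁)
  obtain ⟨e₂⟩ : Nonempty (Fin (msgCard n R2) ↪ Fin C₂ × Fin K₂) :=
    Function.Embedding.nonempty_of_card_le (by simpa using hm₂)
  obtain ⟨enc, dec₁, dec₂, hcode⟩ := h
    (Fin (msgCard n R0) × Fin (msgCard n R1) × Fin (msgCard n R2))
    fun m => (g (m.1, (e₁ m.2.1).1, (e₂ m.2.2).1), (e₁ m.2.1).2, (e₂ m.2.2).2)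
  refine ⟨enc,
    fun y => ((g.symm (dec₁ y).1).1,
      Function.invFun e₁ ((g.symm (dec₁ y).1).2.1, (dec₁ y).2)),
    fun y => ((g.symm (dec₂ y).1).1,
      Function.invFun e₂ ((g.symm (dec₂ y).1).2.2, (dec₂ y).2)), ?_⟩
  rw [errProbNoFB_eq, one_div_mul_eq_div, div_le_iff₀ (by
    have a0 : (0 : ℝ) < msgCard n R0 := by exact_mod_cast one_le_msgCard n h0
    have a1 : (0 : ℝ) < msgCard n R1 := by exact_mod_cast one_le_msgCard n h1
    have a2 : (0 : ℝ) < msgCard n R2 := by exact_mod_cast one_le_msgCard n h2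
    positivity)]
  refine (Finset.sum_le_sum fun m _ => wExp_mono (isPMF_piW fun t => hW _) fun y =>
    ind_mono ?_).trans (hcode.trans_eq ?_)
  · contrapose!
    rintro ⟨hd₁, hd₂⟩
    rw [hd₁, hd₂]
    simp [Function.leftInverse_invFun e₁.injective _, Function.leftInverse_invFun e₂.injective _]
  · simp only [Fintype.card_prod, Fintype.card_fin, Nat.cast_mul]
    ring

/-- Number of bins at rate `r`. -/
def binCard (r : ℝ) (n : ℕ) : ℕ := ⌈(2 : ℝ) ^ (n * r)⌉₊

lemma rpow_le_binCard (r : ℝ) (n : ℕ) : (2 : ℝ) ^ (n * r) ≤ binCard r n := Nat.le_ceil _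

lemma one_le_binCard (r : ℝ) (n : ℕ) : 1 ≤ binCard r n :=
  Nat.one_le_ceil_iff.2 (Real.rpow_pos_of_pos two_pos _)

lemma binCard_le {r : ℝ} (hr : 0 ≤ r) (n : ℕ) : (binCard r n : ℝ) ≤ 2 * 2 ^ (n * r) := by
  have h := Nat.ceil_lt_add_one (Real.rpow_nonneg two_pos.le ((n : ℝ) * r))
  have h1 : (1 : ℝ) ≤ 2 ^ (n * r) := Real.one_le_rpow one_le_two (by positivity)
  rw [binCard]
  linarith

lemma binCard_zero (n : ℕ) : binCard 0 n = 1 := by simp [binCard]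

lemma msgCard_le_binCard_mul (n : ℕ) (R r : ℝ) :
    msgCard n R ≤ binCard (R - r) n * binCard r n := by
  have h : (msgCard n R : ℝ) ≤ binCard (R - r) n * binCard r n := by
    refine (msgCard_le n R).trans ?_
    have e : (2 : ℝ) ^ (n * R) = 2 ^ (n * (R - r)) * 2 ^ (n * r) := by
      rw [← Real.rpow_add two_pos]; ring_nf
    rw [e]
    gcongr <;> exact rpow_le_binCard _ _
  exact_mod_cast h

lemma cloudCard_le (n : ℕ) {R0 R1 R2 r s : ℝ} (hr : r ≤ R1) (hs : s ≤ R2) :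
    ((msgCard n R0 * binCard (R1 - r) n * binCard (R2 - s) n : ℕ) : ℝ)
      ≤ 4 * 2 ^ (n * (R0 + R1 + R2 - r - s)) := by
  have e : (2 : ℝ) ^ (n * (R0 + R1 + R2 - r - s))
      = 2 ^ (n * R0) * 2 ^ (n * (R1 - r)) * 2 ^ (n * (R2 - s)) := by
    rw [← Real.rpow_add two_pos, ← Real.rpow_add two_pos]; ring_nf
  push_cast
  calc (msgCard n R0 : ℝ) * binCard (R1 - r) n * binCard (R2 - s) n
      ≤ 2 ^ (n * R0) * (2 * 2 ^ (n * (R1 - r))) * (2 * 2 ^ (n * (R2 - s))) := by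
        gcongr
        · exact msgCard_le n R0
        · exact binCard_le (sub_nonneg.2 hr) n
        · exact binCard_le (sub_nonneg.2 hs) n
    _ = 4 * 2 ^ (n * (R0 + R1 + R2 - r - s)) := by rw [e]; ring

lemma tendsto_rpow_div_binCard {i l₁ l₂ : ℝ} (h : i < l₁ + l₂) :
    Filter.Tendsto (fun n : ℕ => (2 : ℝ) ^ (n * i) / (binCard l₁ n * binCard l₂ n))
      Filter.atTop (nhds 0) := by
  refine squeeze_zero (fun n => by positivity) (fun n => ?_)
    (tendsto_two_rpow_nat_mul (a := i - (l₁ + l₂)) (by linarith))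
  have e : (2 : ℝ) ^ (n * (i - (l₁ + l₂))) = 2 ^ (n * i) / (2 ^ (n * l₁) * 2 ^ (n * l₂)) := by
    rw [← Real.rpow_add two_pos, ← Real.rpow_sub two_pos]; ring_nf
  rw [e]
  gcongr <;> exact rpow_le_binCard _ _

end Messages

end BCFB

namespace BCFB

/-! ### Choice of auxiliary rates -/

section Rates

lemma exists_rates_of_eq_zero {R0 R1 R2 m m1 m2 I2 I12 : ℝ} (h2 : 0 ≤ R2)
    (h12 : 0 ≤ I12) (hm1 : m ≤ m1) (hm2 : m ≤ m2) (hR1 : R0 + R1 < m1)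
    (hS : R0 + R1 + R2 < I2 + m - I12) (hmS : m ≤ R0 + R1 + R2) :
    ∃ s l₁ l₂ : ℝ, 0 ≤ s ∧ s ≤ R2 ∧ 0 ≤ l₁ ∧ 0 ≤ l₂ ∧ I12 < l₁ + l₂ ∧
      R0 + R1 + R2 - s < m1 ∧ s + l₂ < I2 ∧ R0 + R1 + R2 + l₂ < m2 + I2 := by
  rcases lt_or_ge (R0 + R1 + R2) m1 with h | h
  · exact ⟨0, I12 + 1, 0, le_rfl, h2, by linarith, le_rfl, by linarith, by linarith, by linarith,
      by linarith⟩
  · obtain ⟨s, hs, hs'⟩ := exists_between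
      (show R0 + R1 + R2 - m1 < min R2 I2 from lt_min (by linarith) (by linarith))
    rw [lt_min_iff] at hs'
    exact ⟨s, I12 + 1, 0, by linarith, hs'.1.le, by linarith, le_rfl, by linarith, by linarith,
      by linarith [hs'.2], by linarith⟩

lemma exists_rates_of_pos {R0 R1 R2 m m1 m2 I1 I2 I12 : ℝ} (h1 : 0 ≤ R1)
    (h2 : 0 ≤ R2) (hI1 : 0 < I1) (hI2 : 0 < I2) (h12 : 0 ≤ I12) (hm1 : m ≤ m1) (hm2 : m ≤ m2)
    (hR0 : R0 < m) (hR1 : R0 + R1 < m1 + I1) (hR2 : R0 + R2 < m2 + I2)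
    (hS : R0 + R1 + R2 < I1 + I2 + m - I12) (hmS : m ≤ R0 + R1 + R2) :
    ∃ r s l₁ l₂ : ℝ, 0 ≤ r ∧ r ≤ R1 ∧ 0 ≤ s ∧ s ≤ R2 ∧ 0 ≤ l₁ ∧ 0 ≤ l₂ ∧ I12 < l₁ + l₂ ∧
      r + l₁ < I1 ∧ R0 + R1 + R2 - r - s + r + l₁ < m1 + I1 ∧
      s + l₂ < I2 ∧ R0 + R1 + R2 - r - s + s + l₂ < m2 + I2 := by
  obtain ⟨S, rfl⟩ : ∃ S, S - R1 - R2 = R0 := ⟨R0 + R1 + R2, by ring⟩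
  obtain ⟨ε, hε, hε'⟩ : ∃ ε > 0, 4 * ε ≤ min (min I1 I2) (min (min (m1 + I1 + R2 - S)
      (m2 + I2 + R1 - S)) (min (I1 + I2 + m - I12 - S) (m + R1 + R2 - S))) := by
    have : 0 < min (min I1 I2) (min (min (m1 + I1 + R2 - S)
        (m2 + I2 + R1 - S)) (min (I1 + I2 + m - I12 - S) (m + R1 + R2 - S))) := by
      simp only [lt_min_iff]
      refine ⟨⟨hI1, hI2⟩, ⟨?_, ?_⟩, ?_, ?_⟩ <;> linarith
    exact ⟨_, div_pos this four_pos, by linarith⟩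
  simp only [le_min_iff] at hε'
  obtain ⟨⟨e1, e2⟩, ⟨e3, e4⟩, e5, e6⟩ := hε'
  obtain ⟨A, hA⟩ : ∃ A, A = max 0 (S - m2 - I2 + ε) := ⟨_, rfl⟩
  obtain ⟨B, hB⟩ : ∃ B, B = min R1 (I1 - ε) := ⟨_, rfl⟩
  obtain ⟨C, hC⟩ : ∃ C, C = max 0 (S - m1 - I1 + ε) := ⟨_, rfl⟩
  obtain ⟨D, hD⟩ : ∃ D, D = min R2 (I2 - ε) := ⟨_, rfl⟩
  have hA1 : 0 ≤ A := hA ▸ le_max_left _ _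
  have hA2 : S - m2 - I2 + ε ≤ A := hA ▸ le_max_right _ _
  have hC1 : 0 ≤ C := hC ▸ le_max_left _ _
  have hC2 : S - m1 - I1 + ε ≤ C := hC ▸ le_max_right _ _
  have hB1 : B ≤ R1 := hB ▸ min_le_left _ _
  have hB2 : B ≤ I1 - ε := hB ▸ min_le_right _ _
  have hD1 : D ≤ R2 := hD ▸ min_le_left _ _
  have hD2 : D ≤ I2 - ε := hD ▸ min_le_right _ _
  have hAB : A ≤ B := by
    rw [hA, hB]; refine max_le (le_min ?_ ?_) (le_min ?_ ?_) <;> linarith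
  have hCD : C ≤ D := by
    rw [hC, hD]; refine max_le (le_min ?_ ?_) (le_min ?_ ?_) <;> linarith
  have hlo : 2 * S - (m1 + I1) - (m2 + I2) + I12 + ε ≤ B + D := by
    rcases min_choice R1 (I1 - ε) with hb | hb <;> rcases min_choice R2 (I2 - ε) with hd | hd <;>
      rw [hB, hD, hb, hd] <;> linarith
  have hhi : A + C ≤ I1 + I2 - I12 - ε := by
    rcases max_choice 0 (S - m2 - I2 + ε) with ha | ha <;>
      rcases max_choice 0 (S - m1 - I1 + ε) with hc | hc <;>
      rw [hA, hC, ha, hc] <;> linarith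
  obtain ⟨t, ht⟩ : ∃ t, t = max (A + C) (2 * S - (m1 + I1) - (m2 + I2) + I12 + ε) := ⟨_, rfl⟩
  have ht1 : A + C ≤ t := ht ▸ le_max_left _ _
  have ht2 : 2 * S - (m1 + I1) - (m2 + I2) + I12 + ε ≤ t := ht ▸ le_max_right _ _
  have ht3 : t ≤ B + D := ht ▸ max_le (by linarith) hlo
  have ht4 : t ≤ I1 + I2 - I12 - ε := ht ▸ max_le hhi (by linarith)
  obtain ⟨r, hr⟩ : ∃ r, r = max A (t - D) := ⟨_, rfl⟩
  have hr1 : A ≤ r := hr ▸ le_max_left _ _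
  have hr2 : t - D ≤ r := hr ▸ le_max_right _ _
  have hr3 : r ≤ B := hr ▸ max_le hAB (by linarith)
  have hr4 : r ≤ t - C := hr ▸ max_le (by linarith) (by linarith)
  obtain ⟨l, hl⟩ : ∃ l, l = min (I1 - r) (m1 + I1 - S + (t - r)) := ⟨_, rfl⟩
  obtain ⟨k, hk⟩ : ∃ k, k = min (I2 - (t - r)) (m2 + I2 - S + r) := ⟨_, rfl⟩
  have hl1 : l ≤ I1 - r := hl ▸ min_le_left _ _
  have hl2 : l ≤ m1 + I1 - S + (t - r) := hl ▸ min_le_right _ _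
  have hl3 : ε ≤ l := hl ▸ le_min (by linarith) (by linarith)
  have hk1 : k ≤ I2 - (t - r) := hk ▸ min_le_left _ _
  have hk2 : k ≤ m2 + I2 - S + r := hk ▸ min_le_right _ _
  have hk3 : ε ≤ k := hk ▸ le_min (by linarith) (by linarith)
  have hlk : I12 + ε ≤ l + k := by
    rcases min_choice (I1 - r) (m1 + I1 - S + (t - r)) with ha | ha <;>
      rcases min_choice (I2 - (t - r)) (m2 + I2 - S + r) with hc | hc <;>
      rw [hl, hk, ha, hc] <;> linarith
  exact ⟨r, t - r, l - ε / 4, k - ε / 4, by linarith, by linarith, by linarith, by linarith,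
    by linarith, by linarith, by linarith, by linarith, by linarith, by linarith, by linarith⟩

lemma exists_rates {R0 R1 R2 m m1 m2 I1 I2 I12 : ℝ} (h1 : 0 ≤ R1) (h2 : 0 ≤ R2)
    (hI1 : 0 ≤ I1) (hI2 : 0 ≤ I2) (h12 : 0 ≤ I12) (hm1 : m ≤ m1) (hm2 : m ≤ m2)
    (hR0 : R0 < m) (hR1 : R0 + R1 < m1 + I1) (hR2 : R0 + R2 < m2 + I2)
    (hS : R0 + R1 + R2 < I1 + I2 + m - I12) :
    ∃ r s l₁ l₂ : ℝ, 0 ≤ r ∧ r ≤ R1 ∧ 0 ≤ s ∧ s ≤ R2 ∧ 0 ≤ l₁ ∧ 0 ≤ l₂ ∧ I12 < l₁ + l₂ ∧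
      ((r + l₁ < I1 ∧ R0 + R1 + R2 - r - s + r + l₁ < m1 + I1) ∨
        (r = 0 ∧ R0 + R1 + R2 - r - s < m1)) ∧
      ((s + l₂ < I2 ∧ R0 + R1 + R2 - r - s + s + l₂ < m2 + I2) ∨
        (s = 0 ∧ R0 + R1 + R2 - r - s < m2)) := by
  rcases lt_or_ge (R0 + R1 + R2) m with h | h
  · exact ⟨0, 0, I12 + 1, 0, le_rfl, h1, le_rfl, h2, by linarith, le_rfl, by linarith,
      Or.inr ⟨rfl, by linarith⟩, Or.inr ⟨rfl, by linarith⟩⟩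
  rcases hI1.eq_or_lt with rfl | hI1
  · obtain ⟨s, l₁, l₂, a1, a2, a3, a4, a5, a6, a7, a8⟩ := exists_rates_of_eq_zero (R0 := R0)
      (R1 := R1) (I2 := I2) h2 h12 hm1 hm2 (by linarith) (by linarith) h
    exact ⟨0, s, l₁, l₂, le_rfl, h1, a1, a2, a3, a4, a5, Or.inr ⟨rfl, by linarith⟩,
      Or.inl ⟨a7, by linarith⟩⟩
  rcases hI2.eq_or_lt with rfl | hI2
  · obtain ⟨r, l₂, l₁, a1, a2, a3, a4, a5, a6, a7, a8⟩ := exists_rates_of_eq_zero (R0 := R0)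
      (R1 := R2) (I2 := I1) h1 h12 hm2 hm1 (by linarith) (by linarith) (by linarith)
    exact ⟨r, 0, l₁, l₂, a1, a2, le_rfl, h2, a4, a3, by linarith, Or.inl ⟨a7, by linarith⟩,
      Or.inr ⟨rfl, by linarith⟩⟩
  obtain ⟨r, s, l₁, l₂, a1, a2, a3, a4, a5, a6, a7, a8, a9, a10, a11⟩ :=
    exists_rates_of_pos h1 h2 hI1 hI2 h12 hm1 hm2 hR0 hR1 hR2 hS h
  exact ⟨r, s, l₁, l₂, a1, a2, a3, a4, a5, a6, a7, Or.inl ⟨a8, a9⟩, Or.inl ⟨a10, a11⟩⟩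

end Rates

end BCFB

namespace BCFB

lemma MartonCond.achievableNoFB {X Y1 Y2 : Type*} [Fintype X] [Fintype Y1] [Fintype Y2]
    {W : X → Y1 × Y2 → ℝ} (hW : IsKernel W) {R0 R1 R2 : ℝ} (h0 : 0 ≤ R0) (h1 : 0 ≤ R1)
    (h2 : 0 ≤ R2) (h : MartonCond W R0 R1 R2) : AchievableNoFB W R0 R1 R2 := by
  obtain ⟨k0, k1, k2, p, f, hp, hm, hR1, hR2, hS⟩ := h
  have : Nonempty X := by
    by_contra hX
    have : IsEmpty (Fin k0 × Fin k1 × Fin k2) := ⟨fun u => hX ⟨f u⟩⟩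
    simpa using hp.2
  have hV : IsKernel fun u => W (f u) := fun u => hW _
  have hw := isPMF_joint hp hV
  obtain ⟨w, hwd⟩ : ∃ w, w = fun z : (Fin k0 × Fin k1 × Fin k2) × Y1 × Y2 =>
    p z.1 * W (f z.1) z.2 := ⟨_, rfl⟩
  simp only [← hwd] at hm hR1 hR2 hS hw
  obtain ⟨r, s, l₁, l₂, hr, hr', hs, hs', hl₁, hl₂, hl, hd₁, hd₂⟩ := exists_rates h1 h2
    (cmiOf_nonneg hw (fun z => z.1.2.1) (fun z => z.2.1) fun z => z.1.1)
    (cmiOf_nonneg hw (fun z => z.1.2.2) (fun z => z.2.2) fun z => z.1.1)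
    (cmiOf_nonneg hw (fun z => z.1.2.1) (fun z => z.1.2.2) fun z => z.1.1)
    (min_le_left _ _) (min_le_right _ _) hm
    (hR1.trans_eq (miOf_pair_eq_add w (fun z => z.1.1) (fun z => z.1.2.1) fun z => z.2.1))
    (hR2.trans_eq (miOf_pair_eq_add w (fun z => z.1.1) (fun z => z.1.2.2) fun z => z.2.2)) hS
  have hC1 : ∀ n, 1 ≤ msgCard n R0 * binCard (R1 - r) n * binCard (R2 - s) n := fun n =>
    Nat.mul_pos (Nat.mul_pos (one_le_msgCard n h0) (one_le_binCard _ n)) (one_le_binCard _ n)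
  have hOK₁ : ReceiverOK w (fun z => z.1.1) (fun z => z.1.2.1) (fun z => z.2.1) (binCard r)
      (binCard l₁) fun n => msgCard n R0 * binCard (R1 - r) n * binCard (R2 - s) n := by
    rcases hd₁ with ⟨ha, hb⟩ | ⟨rfl, hb⟩
    · exact receiverOK_of_lt hw _ _ _ (one_le_binCard _) hC1 (binCard_le hr) (binCard_le hl₁)
        (fun n => cloudCard_le n hr' hs') ha
        (hb.trans_eq (miOf_pair_eq_add w (fun z => z.1.1) (fun z => z.1.2.1) fun z => z.2.1).symm)
    · exact receiverOK_of_lt_center hw _ _ _ binCard_zero hC1 (fun n => cloudCard_le n hr' hs') hb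
  have hOK₂ : ReceiverOK w (fun z => z.1.1) (fun z => z.1.2.2) (fun z => z.2.2) (binCard s)
      (binCard l₂) fun n => msgCard n R0 * binCard (R1 - r) n * binCard (R2 - s) n := by
    rcases hd₂ with ⟨ha, hb⟩ | ⟨rfl, hb⟩
    · exact receiverOK_of_lt hw _ _ _ (one_le_binCard _) hC1 (binCard_le hs) (binCard_le hl₂)
        (fun n => cloudCard_le n hr' hs') ha
        (hb.trans_eq (miOf_pair_eq_add w (fun z => z.1.1) (fun z => z.1.2.2) fun z => z.2.2).symm)
    · exact receiverOK_of_lt_center hw _ _ _ binCard_zero hC1 (fun n => cloudCard_le n hr' hs') hb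
  obtain ⟨i, hi, hi'⟩ := exists_between hl
  refine achievableNoFB_of_eventually hW h0 h1 h2 fun ε hε => ?_
  filter_upwards [eventually_exists_code hp hV hwd (one_le_binCard r) (one_le_binCard s)
    (one_le_binCard l₁) (one_le_binCard l₂) hC1 hOK₁ hOK₂ hi (tendsto_rpow_div_binCard hi') hε]
    with n hn
  refine exists_code_of_splitting hW h0 h1 h2 (msgCard_le_binCard_mul n R1 r)
    (msgCard_le_binCard_mul n R2 s) fun M _ φ => ?_
  obtain ⟨enc, dec₁, dec₂, hcode⟩ := hn M φ
  exact ⟨fun m t => f (enc m t), dec₁, dec₂, hcode⟩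

/-- **Theorem 1 (Marton).** For every discrete memoryless broadcast channel,
Marton's region is contained in the no-feedback capacity region. -/
theorem marton_subset_noFB_capacity
    {X Y1 Y2 : Type*} [Fintype X] [Fintype Y1] [Fintype Y2]
    (W : X → Y1 × Y2 → ℝ) (hW : IsKernel W) :
    MartonRegion W ⊆ CNoFB W := by
  exact closure_mono fun _ ⟨h0, h1, h2, h⟩ => h.achievableNoFB hW h0 h1 h2

end BCFB
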